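/- arXiv:2211.04040 — 11 statements merged into one kernel-verified Lean document; each statement's English description precedes it below -/
import Mathlib

section
/- Let t be a real number and let h : ℝ → ℝ be twice differentiable on (0, ∞) and satisfy the differential equation x²·h''(x) + x·h'(x) = (2x + x² + t²)·h(x) for every x > 0. Assume that h(x) tends to 0 as x → +∞ and that there exists A > 0 such that h(x) > 0 for all x ≥ A. Then h(x) > 0 for every x > 0; in particular h has no zero in (0, ∞). -/
open Real Filter Set

theorem IsLocalMax.deriv_deriv_nonpos {f : ℝ → ℝ} {y : ℝ} (hy : IsLocalMax f y)
    (hf : ContinuousAt f y) : deriv (deriv f) y ≤ 0 := by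
  by_contra! hpos
  have hmin : IsLocalMin f y := isLocalMin_of_deriv_deriv_pos hpos hy.deriv_eq_zero hf
  have hconst : f =ᶠ[nhds y] fun _ => f y := by
    filter_upwards [hy, hmin] with z h₁ h₂ using le_antisymm h₁ h₂
  have hzero : deriv (deriv f) y = 0 := by
    rw [hconst.deriv.deriv_eq]
    simp
  exact hpos.ne' hzero

/-- A function continuous on `[a, ∞)` that tends to `0` at infinity, is nonpositive at `a` and
takes a positive value to the right of `a` has a positive local maximum in `(a, ∞)`. -/
theorem exists_isLocalMax_pos_of_tendsto_zero {f : ℝ → ℝ} {a b : ℝ}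
    (hf : ContinuousOn f (Ici a)) (hlim : Tendsto f atTop (nhds 0))
    (ha : f a ≤ 0) (hab : a < b) (hb : 0 < f b) :
    ∃ y > a, 0 < f y ∧ IsLocalMax f y := by
  have hev := hlim.eventually_lt_const hb
  obtain ⟨y, hya, hy⟩ : ∃ y ∈ Ici a, IsMaxOn f (Ici a) y := by
    refine hf.exists_isMaxOn' isClosed_Ici (mem_Ici.2 hab.le) ?_
    rw [cocompact_eq_atBot_atTop, inf_sup_right, eventually_sup]
    refine ⟨?_, (hev.mono fun _ h => h.le).filter_mono inf_le_left⟩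
    rw [eventually_inf_principal]
    filter_upwards [eventually_lt_atBot a] with z hz hz'
    exact absurd hz (not_lt.2 hz')
  have hpos : 0 < f y := hb.trans_le (hy (mem_Ici.2 hab.le))
  have hlt : a < y := lt_of_le_of_ne hya fun h => by
    rw [← h] at hpos
    exact hpos.not_ge ha
  exact ⟨y, hlt, hpos, hy.isLocalMax (Ici_mem_nhds hlt)⟩

/-- If `h` is twice differentiable on `(0, ∞)`, satisfies the ODE
`x² h''(x) + x h'(x) = (2x + x² + t²) h(x)` there, tends to `0` at `+∞`, and is
eventually strictly positive, then `h` is strictly positive on all of `(0, ∞)`. -/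
theorem stmt0 (t : ℝ) (h : ℝ → ℝ)
    (hdiff : ∀ x ∈ Set.Ioi (0:ℝ), DifferentiableAt ℝ h x ∧ DifferentiableAt ℝ (deriv h) x)
    (hode : ∀ x ∈ Set.Ioi (0:ℝ),
      x ^ 2 * deriv (deriv h) x + x * deriv h x = (2 * x + x ^ 2 + t ^ 2) * h x)
    (hlim : Tendsto h atTop (nhds 0))
    (hpos : ∃ A > (0:ℝ), ∀ x ≥ A, 0 < h x) :
    ∀ x ∈ Set.Ioi (0:ℝ), 0 < h x := by
  intro x hx
  obtain ⟨A, -, hA⟩ := hpos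
  by_contra! hxle
  have hxA : x < A := lt_of_not_ge fun hAx => (hA x hAx).not_ge hxle
  have hcont : ContinuousOn h (Ici x) := fun z hz =>
    (hdiff z (mem_Ioi.2 (lt_of_lt_of_le hx hz))).1.continuousAt.continuousWithinAt
  obtain ⟨y, hxy, hy, hmax⟩ :=
    exists_isLocalMax_pos_of_tendsto_zero hcont hlim hxle hxA (hA A le_rfl)
  have hy0 : 0 < y := lt_trans hx hxy
  have hsecond := hmax.deriv_deriv_nonpos (hdiff y hy0).1.continuousAt
  have hrhs : 0 < (2 * y + y ^ 2 + t ^ 2) * h y := by positivity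
  rw [← hode y hy0, hmax.deriv_eq_zero, mul_zero, add_zero] at hrhs
  exact hrhs.not_ge (mul_nonpos_of_nonneg_of_nonpos (sq_nonneg y) hsecond)
end

section
/- For every real x with 0 ≤ x < 1 one has ∑_{n=2}^∞ ζ(n)·x^{n−1} = −ψ(1−x) − γ, where ζ is the Riemann zeta function, ψ = Γ'/Γ is the digamma function (the logarithmic derivative of the Gamma function), and γ is the Euler–Mascheroni constant. In particular the series on the left converges for 0 ≤ x < 1. -/
open Real Filter

/-- The values `ζ(n) = ∑_{k=1}^∞ k^{-n}` of the Riemann zeta function at integers `n ≥ 2`. -/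
noncomputable def zetaNat (n : ℕ) : ℝ := ∑' k : ℕ, (1 : ℝ) / ((k : ℝ) + 1) ^ n

/-- The digamma function `ψ = Γ'/Γ`, the logarithmic derivative of the Gamma function. -/
noncomputable def digamma (x : ℝ) : ℝ := deriv (fun y => Real.log (Real.Gamma y)) x

theorem differentiableAt_log_Gamma {y : ℝ} (hy : 0 < y) :
    DifferentiableAt ℝ (fun t => Real.log (Real.Gamma t)) y :=
  (Real.differentiableAt_Gamma fun m => by
    have : (0 : ℝ) ≤ m := m.cast_nonneg
    linarith).log (Real.Gamma_pos_of_pos hy).ne'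

theorem digamma_one : digamma 1 = -Real.eulerMascheroniConstant := by
  unfold digamma
  rw [(Real.hasDerivAt_Gamma_one.log (by simp)).deriv, Real.Gamma_one, div_one]

theorem digamma_add_one {y : ℝ} (hy : 0 < y) : digamma (y + 1) = digamma y + y⁻¹ := by
  unfold digamma
  rw [← deriv_comp_add_const, ← Real.deriv_log,
    ← deriv_add (differentiableAt_log_Gamma hy) (Real.differentiableAt_log hy.ne')]
  apply EventuallyEq.deriv_eq
  filter_upwards [eventually_gt_nhds hy] with t ht
  rw [Real.Gamma_add_one ht.ne', Real.log_mul ht.ne' (Real.Gamma_pos_of_pos ht).ne', add_comm]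
  rfl

theorem digamma_add_natCast {y : ℝ} (hy : 0 < y) (n : ℕ) :
    digamma (y + n) = digamma y + ∑ k ∈ Finset.range n, (y + k)⁻¹ := by
  induction n with
  | zero => simp
  | succ n ih =>
    rw [Nat.cast_succ, ← add_assoc, digamma_add_one (by positivity), ih, Finset.sum_range_succ,
      add_assoc]

theorem monotoneOn_digamma : MonotoneOn digamma (Set.Ioi 0) :=
  Real.convexOn_log_Gamma.monotoneOn_deriv fun _ hy => differentiableAt_log_Gamma hy

/-- The increments of `ψ` over a bounded step vanish at infinity. -/
theorem tendsto_digamma_sub_digamma {x : ℝ} (hx0 : 0 ≤ x) (hx1 : x < 1) :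
    Tendsto (fun n : ℕ => digamma (1 - x + n) - digamma (1 + n)) atTop (nhds 0) := by
  have hinv : Tendsto (fun n : ℕ => -(n : ℝ)⁻¹) atTop (nhds 0) := by
    simpa using (tendsto_inv_atTop_nhds_zero_nat (𝕜 := ℝ)).neg
  refine tendsto_of_tendsto_of_tendsto_of_le_of_le' hinv tendsto_const_nhds ?_ ?_
  · filter_upwards [eventually_gt_atTop 0] with n hn
    have hn' : (0 : ℝ) < n := Nat.cast_pos.mpr hn
    have hle : digamma n ≤ digamma (1 - x + n) :=
      monotoneOn_digamma hn' (Set.mem_Ioi.mpr (by linarith)) (by linarith)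
    rw [add_comm (1 : ℝ) n, digamma_add_one hn']
    linarith
  · filter_upwards with n
    have hn : (0 : ℝ) ≤ n := n.cast_nonneg
    exact sub_nonpos.mpr (monotoneOn_digamma (Set.mem_Ioi.mpr (by linarith))
      (Set.mem_Ioi.mpr (by linarith)) (by linarith))

/-- The partial fraction expansion of the digamma function. -/
theorem hasSum_inv_sub_inv_digamma {x : ℝ} (hx0 : 0 ≤ x) (hx1 : x < 1) :
    HasSum (fun k : ℕ => (1 - x + k)⁻¹ - (1 + (k : ℝ))⁻¹)
      (-digamma (1 - x) - Real.eulerMascheroniConstant) := by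
  have hnonneg (k : ℕ) : 0 ≤ (1 - x + k)⁻¹ - (1 + (k : ℝ))⁻¹ := by
    have hk : (0 : ℝ) ≤ k := k.cast_nonneg
    exact sub_nonneg.mpr (inv_anti₀ (by linarith) (by linarith))
  rw [hasSum_iff_tendsto_nat_of_nonneg hnonneg]
  have h := (tendsto_digamma_sub_digamma hx0 hx1).add_const
    (-digamma (1 - x) - Real.eulerMascheroniConstant)
  rw [zero_add] at h
  refine h.congr fun n => ?_
  rw [digamma_add_natCast (by linarith), digamma_add_natCast one_pos, digamma_one,
    Finset.sum_sub_distrib]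
  ring

theorem hasSum_pow_div_pow {x a : ℝ} (hx0 : 0 ≤ x) (hxa : x < a) :
    HasSum (fun n : ℕ => 1 / a ^ (n + 2) * x ^ (n + 1)) ((a - x)⁻¹ - a⁻¹) := by
  have ha : 0 < a := hx0.trans_lt hxa
  have hax : a - x ≠ 0 := by linarith
  have h := (hasSum_geometric_of_lt_one (div_nonneg hx0 ha.le)
    ((div_lt_one ha).mpr hxa)).mul_left (x / a ^ 2)
  have hsum : x / a ^ 2 * (1 - x / a)⁻¹ = (a - x)⁻¹ - a⁻¹ := by
    rw [one_sub_div ha.ne']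
    field_simp
    ring
  rw [hsum] at h
  refine h.congr_fun fun n => ?_
  rw [div_pow]
  field_simp
  ring

theorem HasSum.comm_of_nonneg {α β : Type*} {f : α → β → ℝ} {g : α → ℝ} {s : ℝ}
    (hf : ∀ k n, 0 ≤ f k n)
    (hg : ∀ k, HasSum (f k) (g k)) (hs : HasSum g s) :
    HasSum (fun n => ∑' k, f k n) s := by
  have hsummable : Summable (Function.uncurry f) := by
    refine (summable_prod_of_nonneg fun p => hf p.1 p.2).mpr ⟨fun k => (hg k).summable, ?_⟩
    exact hs.summable.congr fun k => (hg k).tsum_eq.symm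
  have hfs : HasSum (Function.uncurry f) s := by
    have h := hsummable.hasSum
    rwa [(h.prod_fiberwise hg).unique hs] at h
  have hswap := (Equiv.prodComm β α).hasSum_iff.mpr hfs
  exact hswap.prod_fiberwise fun n => (hswap.summable.prod_factor n).hasSum

/-- For `0 ≤ x < 1`, `∑_{n=2}^∞ ζ(n) x^{n-1} = -ψ(1-x) - γ`; in particular the
series converges. -/
theorem stmt1 (x : ℝ) (hx0 : 0 ≤ x) (hx1 : x < 1) :
    HasSum (fun n : ℕ => zetaNat (n + 2) * x ^ (n + 1))
      (-digamma (1 - x) - Real.eulerMascheroniConstant) := by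
  have h := HasSum.comm_of_nonneg (f := fun k n : ℕ => 1 / ((k : ℝ) + 1) ^ (n + 2) * x ^ (n + 1))
    (fun k n => by positivity)
    (fun k => hasSum_pow_div_pow hx0 (hx1.trans_le (by linarith [k.cast_nonneg (α := ℝ)])))
    (by convert hasSum_inv_sub_inv_digamma hx0 hx1 using 4 <;> ring)
  simpa only [zetaNat, tsum_mul_right] using h
end

section
/- Fix α ∈ [0,1) and δ ∈ (0,1). For a > 0 and integers k ≥ 1 set β_k(a) = 4παa / (√(4π²(k+α)²a² + k^{2δ}) + √(4π²(k−α)²a² + k^{2δ})). Then 0 ≤ β_k(a) ≤ α/k for all k ≥ 1 and a > 0, the double series ∑_{k=1}^∞ ∑_{n=2}^∞ (1/n)·β_k(a)ⁿ converges, and lim_{a→+∞} ∑_{k=1}^∞ ∑_{n=2}^∞ (1/n)·β_k(a)ⁿ = log Γ(1−α) − γ·α, where Γ is the Gamma function and γ is the Euler–Mascheroni constant. -/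
open Real Filter



/-- The quantity `β_k(a)` appearing in the first part of the study of the terms
`M̃_{μ,k}`, at `μ = 0`. -/
noncomputable def betaK (α δ a : ℝ) (k : ℕ) : ℝ :=
  4 * π * α * a /
    (Real.sqrt (4 * π ^ 2 * ((k : ℝ) + α) ^ 2 * a ^ 2 + (k : ℝ) ^ (2 * δ)) +
      Real.sqrt (4 * π ^ 2 * ((k : ℝ) - α) ^ 2 * a ^ 2 + (k : ℝ) ^ (2 * δ)))

lemma four_pi_mul_le_sum_sqrt {α a x c : ℝ} (hc : 0 ≤ c) :
    4 * π * a * x ≤ √(4 * π ^ 2 * (x + α) ^ 2 * a ^ 2 + c) +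
      √(4 * π ^ 2 * (x - α) ^ 2 * a ^ 2 + c) := by
  have h1 : 2 * π * (x + α) * a ≤ √(4 * π ^ 2 * (x + α) ^ 2 * a ^ 2 + c) :=
    Real.le_sqrt_of_sq_le (by nlinarith)
  have h2 : 2 * π * (x - α) * a ≤ √(4 * π ^ 2 * (x - α) ^ 2 * a ^ 2 + c) :=
    Real.le_sqrt_of_sq_le (by nlinarith)
  linarith

lemma betaK_nonneg {α a : ℝ} (δ : ℝ) (hα0 : 0 ≤ α) (ha : 0 ≤ a) (k : ℕ) :
    0 ≤ betaK α δ a k := by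
  unfold betaK
  positivity

lemma betaK_le {α a : ℝ} (δ : ℝ) (hα0 : 0 ≤ α) (ha : 0 < a) {k : ℕ} (hk : 1 ≤ k) :
    betaK α δ a k ≤ α / k := by
  have hk' : (1 : ℝ) ≤ k := by exact_mod_cast hk
  have hk0 : (0 : ℝ) < k := by linarith
  have h := four_pi_mul_le_sum_sqrt (x := (k : ℝ)) (a := a) (α := α)
    (c := (k : ℝ) ^ (2 * δ)) (by positivity)
  have h0 : 0 < 4 * π * a * k := by positivity
  unfold betaK
  rw [div_le_div_iff₀ (h0.trans_le h) hk0]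
  nlinarith [mul_le_mul_of_nonneg_left h hα0]

lemma betaK_eq_inv {α δ a : ℝ} (ha : 0 < a) (k : ℕ) :
    betaK α δ a k = 4 * π * α /
      (√(4 * π ^ 2 * ((k : ℝ) + α) ^ 2 + (k : ℝ) ^ (2 * δ) * a⁻¹ ^ 2) +
        √(4 * π ^ 2 * ((k : ℝ) - α) ^ 2 + (k : ℝ) ^ (2 * δ) * a⁻¹ ^ 2)) := by
  have key (y c : ℝ) : √(y * a ^ 2 + c) = √(y + c * a⁻¹ ^ 2) * a := by
    rw [← Real.sqrt_sq ha.le, ← Real.sqrt_mul' _ (sq_nonneg a), Real.sqrt_sq ha.le]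
    congr 1
    field_simp
  rw [betaK, key, key, ← add_mul, mul_div_mul_right _ _ ha.ne']

lemma tendsto_betaK_atTop {α : ℝ} (δ : ℝ) (hα0 : 0 ≤ α) (hα1 : α ≤ 1) {k : ℕ} (hk : 1 ≤ k) :
    Tendsto (fun a => betaK α δ a k) atTop (nhds (α / k)) := by
  have hk' : (1 : ℝ) ≤ k := by exact_mod_cast hk
  have h1 : √(4 * π ^ 2 * ((k : ℝ) + α) ^ 2) = 2 * π * (k + α) := by
    rw [← Real.sqrt_sq (show 0 ≤ 2 * π * (k + α) by positivity)]
    congr 1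
    ring
  have h2 : √(4 * π ^ 2 * ((k : ℝ) - α) ^ 2) = 2 * π * (k - α) := by
    rw [← Real.sqrt_sq (show 0 ≤ 2 * π * (k - α) from
      mul_nonneg (by positivity) (by linarith))]
    congr 1
    ring
  have hden : 2 * π * ((k : ℝ) + α) + 2 * π * (k - α) = 4 * π * k := by ring
  have hc : ContinuousAt (fun t : ℝ => 4 * π * α /
      (√(4 * π ^ 2 * ((k : ℝ) + α) ^ 2 + (k : ℝ) ^ (2 * δ) * t ^ 2) +
        √(4 * π ^ 2 * ((k : ℝ) - α) ^ 2 + (k : ℝ) ^ (2 * δ) * t ^ 2))) 0 := by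
    refine ContinuousAt.div (by fun_prop) (by fun_prop) ?_
    simp only [ne_eq, OfNat.ofNat_ne_zero, not_false_eq_true, zero_pow, mul_zero, add_zero]
    rw [h1, h2, hden]
    positivity
  have h := hc.tendsto.comp tendsto_inv_atTop_zero
  simp only [ne_eq, OfNat.ofNat_ne_zero, not_false_eq_true, zero_pow, mul_zero, add_zero] at h
  rw [h1, h2, hden, mul_div_mul_left _ _ (by positivity : (4 * π) ≠ 0)] at h
  refine h.congr' ?_
  filter_upwards [eventually_gt_atTop 0] with a ha
  exact (betaK_eq_inv ha k).symm

lemma one_div_mul_pow_le {α b : ℝ} (hα0 : 0 ≤ α) (hα1 : α ≤ 1) (k n : ℕ) (hb0 : 0 ≤ b)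
    (hb : b ≤ α / ((k + 1 : ℕ) : ℝ)) :
    1 / ((n : ℝ) + 2) * b ^ (n + 2) ≤ 1 / ((k : ℝ) + 1) ^ 2 * α ^ n := by
  push_cast at hb
  have hk : (1 : ℝ) ≤ k + 1 := by linarith [k.cast_nonneg (α := ℝ)]
  have h1 : b ≤ α := hb.trans (div_le_self hα0 hk)
  have h2 : b ≤ 1 / ((k : ℝ) + 1) := hb.trans (by gcongr)
  calc 1 / ((n : ℝ) + 2) * b ^ (n + 2) ≤ 1 * b ^ (n + 2) := by
        gcongr
        rw [div_le_one (by positivity)]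
        linarith [n.cast_nonneg (α := ℝ)]
    _ = b ^ 2 * b ^ n := by ring
    _ ≤ (1 / ((k : ℝ) + 1)) ^ 2 * α ^ n := by gcongr
    _ = _ := by rw [div_pow, one_pow]

lemma summable_one_div_sq_mul_geometric {α : ℝ} (hα0 : 0 ≤ α) (hα1 : α < 1) :
    Summable (fun p : ℕ × ℕ => 1 / ((p.1 : ℝ) + 1) ^ 2 * α ^ p.2) := by
  have h : Summable (fun k : ℕ => 1 / ((k : ℝ) + 1) ^ 2) := by
    exact_mod_cast (summable_nat_add_iff 1).2 (Real.summable_one_div_nat_pow.2 one_lt_two)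
  exact h.mul_of_nonneg (summable_geometric_of_lt_one hα0 hα1)
    (fun _ => by positivity) (fun _ => by positivity)

lemma summable_one_div_mul_pow {α : ℝ} (hα0 : 0 ≤ α) (hα1 : α < 1) {b : ℕ → ℝ}
    (hb0 : ∀ k, 0 ≤ b k) (hb : ∀ k, b k ≤ α / ((k + 1 : ℕ) : ℝ)) :
    Summable (fun p : ℕ × ℕ => 1 / ((p.2 : ℝ) + 2) * b p.1 ^ (p.2 + 2)) := by
  refine Summable.of_nonneg_of_le (fun p => ?_)
    (fun p => one_div_mul_pow_le hα0 hα1.le p.1 p.2 (hb0 p.1) (hb p.1))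
    (summable_one_div_sq_mul_geometric hα0 hα1)
  have := hb0 p.1
  positivity

lemma hasSum_one_div_mul_pow_add_two {x : ℝ} (hx : |x| < 1) :
    HasSum (fun n : ℕ => 1 / ((n : ℝ) + 2) * x ^ (n + 2)) (-log (1 - x) - x) := by
  have h := (hasSum_nat_add_iff' 1).2 (hasSum_pow_div_log_of_abs_lt_one hx)
  simp only [Finset.sum_range_one, Nat.cast_zero, zero_add, pow_one, div_one] at h
  convert! h using 2 with n
  push_cast
  ring

lemma sum_neg_log_one_sub_div_sub {α : ℝ} (hα1 : α < 1) (n : ℕ) :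
    ∑ k ∈ Finset.range n, (-log (1 - α / ((k + 1 : ℕ) : ℝ)) - α / ((k + 1 : ℕ) : ℝ)) =
      Real.BohrMollerup.logGammaSeq (1 - α) n + (log (n + (1 - α)) - log n)
        - α * (harmonic n - log n) := by
  have hlog (k : ℕ) : log (1 - α / ((k + 1 : ℕ) : ℝ)) =
      log (1 - α + k) - log ((k + 1 : ℕ) : ℝ) := by
    have hk : (0 : ℝ) ≤ k := k.cast_nonneg
    push_cast
    rw [← Real.log_div (by linarith) (by positivity)]
    congr 1
    field_simp
    ring
  have hfac : log (n.factorial : ℝ) = ∑ k ∈ Finset.range n, log ((k + 1 : ℕ) : ℝ) := by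
    rw [← Finset.prod_range_add_one_eq_factorial, Nat.cast_prod,
      Real.log_prod (fun k _ => by positivity)]
  have hharm : (harmonic n : ℝ) = ∑ k ∈ Finset.range n, 1 / ((k + 1 : ℕ) : ℝ) := by
    simp [harmonic]
  rw [Real.BohrMollerup.logGammaSeq, Finset.sum_range_succ, hfac, mul_sub, hharm, Finset.mul_sum]
  simp only [hlog, Finset.sum_sub_distrib, Finset.sum_neg_distrib, mul_one_div]
  rw [add_comm (n : ℝ)]
  ring

lemma tendsto_log_natCast_add_sub_log (c : ℝ) :
    Tendsto (fun n : ℕ => log (n + c) - log n) atTop (nhds 0) := by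
  have h : Tendsto (fun n : ℕ => 1 + c / (n : ℝ)) atTop (nhds 1) := by
    simpa using (tendsto_const_div_atTop_nhds_zero_nat c).const_add 1
  have h' := h.log one_ne_zero
  rw [log_one] at h'
  refine h'.congr' ?_
  filter_upwards [eventually_gt_atTop 0, h.eventually_ne one_ne_zero] with n hn hn'
  have hn0 : (n : ℝ) ≠ 0 := by positivity
  have heq : (n : ℝ) + c = n * (1 + c / n) := by field_simp
  rw [heq, Real.log_mul hn0 hn']
  ring

lemma tsum_tsum_div_pow_eq_log_Gamma {α : ℝ} (hα0 : 0 ≤ α) (hα1 : α < 1) :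
    ∑' k : ℕ, ∑' n : ℕ, 1 / ((n : ℝ) + 2) * (α / ((k + 1 : ℕ) : ℝ)) ^ (n + 2) =
      log (Gamma (1 - α)) - eulerMascheroniConstant * α := by
  have hs := summable_one_div_mul_pow hα0 hα1 (b := fun k : ℕ => α / ((k + 1 : ℕ) : ℝ))
    (fun k => by positivity) (fun k => le_rfl)
  have hlim := hs.prod.hasSum.tendsto_sum_nat
  have hinner (k : ℕ) : ∑' n : ℕ, 1 / ((n : ℝ) + 2) * (α / ((k + 1 : ℕ) : ℝ)) ^ (n + 2) =
      -log (1 - α / ((k + 1 : ℕ) : ℝ)) - α / ((k + 1 : ℕ) : ℝ) := by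
    refine (hasSum_one_div_mul_pow_add_two ?_).tsum_eq
    rw [abs_of_nonneg (by positivity)]
    refine (div_le_self hα0 ?_).trans_lt hα1
    push_cast
    linarith [k.cast_nonneg (α := ℝ)]
  refine tendsto_nhds_unique hlim ?_
  simp only [hinner, sum_neg_log_one_sub_div_sub hα1]
  have h := ((Real.BohrMollerup.tendsto_log_gamma (sub_pos.2 hα1)).add
    (tendsto_log_natCast_add_sub_log (1 - α))).sub
    (Real.tendsto_harmonic_sub_log.const_mul α)
  rwa [add_zero, mul_comm α] at h

lemma summable_one_div_mul_betaK_pow {α a : ℝ} (δ : ℝ) (hα0 : 0 ≤ α) (hα1 : α < 1) (ha : 0 < a) :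
    Summable (fun p : ℕ × ℕ =>
      (1 / ((p.2 : ℝ) + 2)) * betaK α δ a (p.1 + 1) ^ (p.2 + 2)) :=
  summable_one_div_mul_pow hα0 hα1 (b := fun k => betaK α δ a (k + 1))
    (fun k => betaK_nonneg δ hα0 ha.le (k + 1))
    (fun k => betaK_le δ hα0 ha (Nat.le_add_left 1 k))

lemma tendsto_tsum_tsum_betaK {α : ℝ} (δ : ℝ) (hα0 : 0 ≤ α) (hα1 : α < 1) :
    Tendsto (fun a : ℝ =>
        ∑' k : ℕ, ∑' n : ℕ, (1 / ((n : ℝ) + 2)) * betaK α δ a (k + 1) ^ (n + 2))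
      atTop (nhds (log (Gamma (1 - α)) - eulerMascheroniConstant * α)) := by
  have hs := summable_one_div_mul_pow hα0 hα1 (b := fun k : ℕ => α / ((k + 1 : ℕ) : ℝ))
    (fun k => by positivity) (fun k => le_rfl)
  rw [← tsum_tsum_div_pow_eq_log_Gamma hα0 hα1, ← hs.tsum_prod]
  have h := tendsto_tsum_of_dominated_convergence (𝓕 := atTop)
    (f := fun (a : ℝ) (p : ℕ × ℕ) =>
      (1 / ((p.2 : ℝ) + 2)) * betaK α δ a (p.1 + 1) ^ (p.2 + 2))
    (summable_one_div_sq_mul_geometric hα0 hα1)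
    (fun p => ((tendsto_betaK_atTop δ hα0 hα1.le (Nat.le_add_left 1 p.1)).pow
      (p.2 + 2)).const_mul (1 / ((p.2 : ℝ) + 2))) (by
        filter_upwards [eventually_gt_atTop 0] with a ha p
        have hp := betaK_nonneg δ hα0 ha.le (p.1 + 1)
        rw [Real.norm_of_nonneg (by positivity)]
        exact one_div_mul_pow_le hα0 hα1.le p.1 p.2 hp
          (betaK_le δ hα0 ha (Nat.le_add_left 1 p.1)))
  refine h.congr' ?_
  filter_upwards [eventually_gt_atTop 0] with a ha
  exact (summable_one_div_mul_betaK_pow δ hα0 hα1 ha).tsum_prod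

/-- `0 ≤ β_k(a) ≤ α/k`, the double series `∑_{k≥1} ∑_{n≥2} β_k(a)ⁿ/n` converges, and
its limit as `a → +∞` is `log Γ(1-α) - γ α`. -/
theorem stmt2 (α δ : ℝ) (hα0 : 0 ≤ α) (hα1 : α < 1) (hδ0 : 0 < δ) (hδ1 : δ < 1) :
    (∀ a > (0:ℝ), ∀ k : ℕ, 1 ≤ k → 0 ≤ betaK α δ a k ∧ betaK α δ a k ≤ α / k) ∧
    (∀ a > (0:ℝ), Summable (fun p : ℕ × ℕ =>
        (1 / ((p.2 : ℝ) + 2)) * betaK α δ a (p.1 + 1) ^ (p.2 + 2))) ∧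
    Tendsto (fun a : ℝ =>
        ∑' k : ℕ, ∑' n : ℕ, (1 / ((n : ℝ) + 2)) * betaK α δ a (k + 1) ^ (n + 2))
      atTop
      (nhds (Real.log (Real.Gamma (1 - α)) - Real.eulerMascheroniConstant * α)) := by
  exact ⟨fun a ha k hk => ⟨betaK_nonneg δ hα0 ha.le k, betaK_le δ hα0 ha hk⟩,
    fun a ha => summable_one_div_mul_betaK_pow δ hα0 hα1 ha,
    tendsto_tsum_tsum_betaK δ hα0 hα1⟩
end

section
/- Let A > 0 and T > 0 be real numbers and let s be a complex number with Re s > 0. Then ∫_T^∞ t^{1−2s}/(A² + t²) dt = (1/(2s)) · T^{2−2s} · (A²+T²)^{−1} · F(1,1; s+1; A²/(A²+T²)), where t^{1−2s} and T^{2−2s} denote complex powers of positive real numbers (via the real logarithm). -/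
open Real Complex MeasureTheory

/-- The Gauss hypergeometric series with complex parameters,
`F(a,b;c;t) = ∑ₙ (a)ₙ (b)ₙ / ((c)ₙ n!) tⁿ`. -/
noncomputable def hypFC (a b c t : ℂ) : ℂ :=
  ∑' n : ℕ, ((ascPochhammer ℂ n).eval a * (ascPochhammer ℂ n).eval b /
      ((ascPochhammer ℂ n).eval c * (Nat.factorial n))) * t ^ n

/-- The weight `1 - T²/t²` lies in `[0, 1]` for `t > T > 0`. -/
theorem norm_one_sub_sq_div_sq_le_one {T t : ℝ} (hT : 0 < T) (ht : T < t) :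
    ‖1 - (T : ℂ) ^ 2 / (t : ℂ) ^ 2‖ ≤ 1 := by
  have ht0 : 0 < t := hT.trans ht
  have h1 : T ^ 2 / t ^ 2 ≤ 1 := by
    rw [div_le_one (by positivity)]
    gcongr
  have h0 : 0 ≤ T ^ 2 / t ^ 2 := by positivity
  have : 1 - (T : ℂ) ^ 2 / (t : ℂ) ^ 2 = ((1 - T ^ 2 / t ^ 2 : ℝ) : ℂ) := by push_cast; rfl
  rw [this, Complex.norm_real, Real.norm_eq_abs, abs_le]
  constructor <;> linarith

theorem aestronglyMeasurable_cpow_mul_one_sub_pow {T : ℝ} (hT : 0 < T) (a : ℂ) (n : ℕ) :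
    AEStronglyMeasurable (fun t : ℝ => (t : ℂ) ^ a * (1 - (T : ℂ) ^ 2 / (t : ℂ) ^ 2) ^ n)
      (volume.restrict (Set.Ioi T)) := by
  refine ContinuousOn.aestronglyMeasurable (fun t ht => ?_) measurableSet_Ioi
  have ht0 : 0 < t := hT.trans ht
  have hne : (t : ℂ) ^ 2 ≠ 0 := pow_ne_zero 2 (ofReal_ne_zero.mpr ht0.ne')
  refine ContinuousAt.continuousWithinAt (ContinuousAt.mul ?_ ?_)
  · exact continuousAt_ofReal_cpow_const t a (Or.inr ht0.ne')
  · exact (continuousAt_const.sub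
      (continuousAt_const.div (continuous_ofReal.continuousAt.pow 2) hne)).pow n

theorem norm_cpow_mul_one_sub_pow_le {T t : ℝ} (hT : 0 < T) (ht : T < t) (a : ℂ) (n : ℕ) :
    ‖(t : ℂ) ^ a * (1 - (T : ℂ) ^ 2 / (t : ℂ) ^ 2) ^ n‖ ≤ t ^ a.re := by
  rw [norm_mul, norm_pow, norm_cpow_eq_rpow_re_of_pos (hT.trans ht)]
  exact mul_le_of_le_one_right (Real.rpow_nonneg (hT.trans ht).le _)
    (pow_le_one₀ (norm_nonneg _) (norm_one_sub_sq_div_sq_le_one hT ht))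

theorem integrableOn_cpow_mul_one_sub_pow {T : ℝ} (hT : 0 < T) {a : ℂ} (ha : a.re < -1) (n : ℕ) :
    IntegrableOn (fun t : ℝ => (t : ℂ) ^ a * (1 - (T : ℂ) ^ 2 / (t : ℂ) ^ 2) ^ n)
      (Set.Ioi T) := by
  refine Integrable.mono' (integrableOn_Ioi_rpow_of_lt ha hT)
    (aestronglyMeasurable_cpow_mul_one_sub_pow hT a n) ?_
  filter_upwards [ae_restrict_mem measurableSet_Ioi] with t ht
  exact norm_cpow_mul_one_sub_pow_le hT ht a n

theorem integral_cpow_mul_one_sub_pow_succ {T : ℝ} (hT : 0 < T) {s : ℂ} (hs : 0 < s.re) (n : ℕ) :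
    (s + 1 + n) * ∫ t in Set.Ioi T,
        (t : ℂ) ^ (-1 - 2 * s) * (1 - (T : ℂ) ^ 2 / (t : ℂ) ^ 2) ^ (n + 1) =
      (n + 1) * ∫ t in Set.Ioi T,
        (t : ℂ) ^ (-1 - 2 * s) * (1 - (T : ℂ) ^ 2 / (t : ℂ) ^ 2) ^ n := by
  have ha : (-1 - 2 * s).re < -1 := by simp [hs]
  have hi := fun m => integrableOn_cpow_mul_one_sub_pow hT ha m
  have hderiv : ∀ t ∈ Set.Ici T, HasDerivAt
      (fun t : ℝ => (t : ℂ) ^ (-2 * s) * (1 - (T : ℂ) ^ 2 / (t : ℂ) ^ 2) ^ (n + 1))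
      (2 * (n + 1) * ((t : ℂ) ^ (-1 - 2 * s) * (1 - (T : ℂ) ^ 2 / (t : ℂ) ^ 2) ^ n) -
        2 * (s + 1 + n) *
          ((t : ℂ) ^ (-1 - 2 * s) * (1 - (T : ℂ) ^ 2 / (t : ℂ) ^ 2) ^ (n + 1))) t := by
    intro t ht
    have ht0 : 0 < t := hT.trans_le ht
    have hne : (t : ℂ) ≠ 0 := ofReal_ne_zero.mpr ht0.ne'
    have h1 : HasDerivAt (fun z : ℂ => z ^ (-2 * s)) (-2 * s * (t : ℂ) ^ (-2 * s - 1)) (t : ℂ) :=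
      hasDerivAt_id (t : ℂ) |>.cpow_const (Or.inl (by simpa using ht0)) |>.congr_deriv (by simp)
    have h2 : HasDerivAt (fun z : ℂ => (1 - (T : ℂ) ^ 2 / z ^ 2) ^ (n + 1))
        ((n + 1) * (1 - (T : ℂ) ^ 2 / (t : ℂ) ^ 2) ^ n * (2 * (T : ℂ) ^ 2 / (t : ℂ) ^ 3))
        (t : ℂ) := by
      have h3 := (((hasDerivAt_const (t : ℂ) ((T : ℂ) ^ 2)).div
        (hasDerivAt_pow 2 (t : ℂ)) (pow_ne_zero 2 hne)).const_sub 1).pow (n + 1)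
      refine h3.congr_deriv ?_
      simp only [Pi.div_apply, Nat.add_sub_cancel]
      push_cast
      field_simp
      ring
    refine (h1.mul h2).comp_ofReal.congr_deriv ?_
    have e1 : (t : ℂ) ^ (-2 * s - 1) = (t : ℂ) ^ (-1 - 2 * s) := by ring_nf
    have e2 : (t : ℂ) ^ (-2 * s) = (t : ℂ) ^ (-1 - 2 * s) * t := by
      nth_rewrite 3 [← cpow_one (t : ℂ)]
      rw [← cpow_add _ _ hne]
      ring_nf
    rw [e1, e2, pow_succ]
    field_simp
    ring
  have hlim : Filter.Tendsto
      (fun t : ℝ => (t : ℂ) ^ (-2 * s) * (1 - (T : ℂ) ^ 2 / (t : ℂ) ^ 2) ^ (n + 1))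
      Filter.atTop (nhds 0) := by
    have hz : Filter.Tendsto (fun t : ℝ => t ^ (-2 * s).re) Filter.atTop (nhds 0) := by
      have := tendsto_rpow_neg_atTop (y := 2 * s.re) (by positivity)
      refine this.congr fun t => ?_
      simp
    refine squeeze_zero_norm' ?_ hz
    filter_upwards [Filter.eventually_gt_atTop T] with t ht
    exact norm_cpow_mul_one_sub_pow_le hT ht _ _
  have key := integral_Ioi_of_hasDerivAt_of_tendsto' hderiv
    (((hi n).const_mul _).sub ((hi (n + 1)).const_mul _)) hlim
  rw [integral_sub ((hi n).const_mul _) ((hi (n + 1)).const_mul _), integral_const_mul,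
    integral_const_mul] at key
  have hTne : (T : ℂ) ≠ 0 := ofReal_ne_zero.mpr hT.ne'
  rw [div_self (pow_ne_zero 2 hTne)] at key
  simp only [sub_self, ne_eq, Nat.add_eq_zero_iff, one_ne_zero, and_false, not_false_eq_true,
    zero_pow, mul_zero] at key
  linear_combination (-1 / 2) * key

theorem ascPochhammer_eval_add_one_ne_zero {s : ℂ} (hs : 0 < s.re) (n : ℕ) :
    (ascPochhammer ℂ n).eval (s + 1) ≠ 0 := by
  rw [Ne, ascPochhammer_eval_eq_zero_iff]
  rintro ⟨k, -, hk⟩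
  have := congrArg Complex.re hk
  simp at this
  have hk0 : (0 : ℝ) ≤ k := k.cast_nonneg
  linarith

/-- A Beta integral: `∫_T^∞ t^{-1-2s} (1 - T²/t²)ⁿ dt = T^{-2s}/(2s) · n!/(s+1)ₙ`. -/
theorem integral_cpow_mul_one_sub_pow {T : ℝ} (hT : 0 < T) {s : ℂ} (hs : 0 < s.re) (n : ℕ) :
    ∫ t in Set.Ioi T, (t : ℂ) ^ (-1 - 2 * s) * (1 - (T : ℂ) ^ 2 / (t : ℂ) ^ 2) ^ n =
      (T : ℂ) ^ (-2 * s) / (2 * s) * (n.factorial / (ascPochhammer ℂ n).eval (s + 1)) := by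
  have hs0 : s ≠ 0 := by rintro rfl; simp at hs
  induction n with
  | zero =>
    have ha : (-1 - 2 * s).re < -1 := by simp [hs]
    simp only [pow_zero, mul_one, integral_Ioi_cpow_of_lt ha hT]
    have : -1 - 2 * s + 1 = -2 * s := by ring
    rw [this]
    simp
  | succ n ih =>
    have hp := ascPochhammer_eval_add_one_ne_zero hs n
    have hp' := ascPochhammer_eval_add_one_ne_zero hs (n + 1)
    rw [ascPochhammer_succ_eval] at hp' ⊢
    have hn := right_ne_zero_of_mul hp'
    have key := integral_cpow_mul_one_sub_pow_succ hT hs n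
    rw [ih] at key
    refine mul_left_cancel₀ hn (key.trans ?_)
    rw [Nat.factorial_succ]
    push_cast
    field_simp

/-- For `A, T > 0` and `Re s > 0`,
`∫_T^∞ t^{1-2s}/(A²+t²) dt = (1/(2s)) T^{2-2s} (A²+T²)⁻¹ F(1,1;s+1;A²/(A²+T²))`. -/
theorem stmt7 (A T : ℝ) (hA : 0 < A) (hT : 0 < T) (s : ℂ) (hs : 0 < s.re) :
    ∫ t in Set.Ioi T, ((t : ℂ) ^ (1 - 2 * s)) / ((A : ℂ) ^ 2 + (t : ℂ) ^ 2) =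
      (1 / (2 * s)) * (T : ℂ) ^ (2 - 2 * s) * ((A : ℂ) ^ 2 + (T : ℂ) ^ 2)⁻¹ *
        hypFC 1 1 (s + 1) (((A ^ 2 / (A ^ 2 + T ^ 2) : ℝ) : ℂ)) := by
  have hs0 : s ≠ 0 := by rintro rfl; simp at hs
  have hTne : (T : ℂ) ≠ 0 := ofReal_ne_zero.mpr hT.ne'
  have ha : (-1 - 2 * s).re < -1 := by simp [hs]
  have hc : 0 < A ^ 2 + T ^ 2 := by positivity
  have hcne : (A : ℂ) ^ 2 + (T : ℂ) ^ 2 ≠ 0 := by exact_mod_cast hc.ne'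
  set z : ℝ := A ^ 2 / (A ^ 2 + T ^ 2) with hz
  have hz0 : 0 ≤ z := by positivity
  have hz1 : z < 1 := by
    rw [hz, div_lt_one hc]
    linarith [pow_pos hT 2]
  have hzn : ‖(z : ℂ)‖ = z := by rw [Complex.norm_real, Real.norm_of_nonneg hz0]
  have hzc : (z : ℂ) = (A : ℂ) ^ 2 / ((A : ℂ) ^ 2 + (T : ℂ) ^ 2) := by rw [hz]; push_cast; rfl
  have hsum := hasSum_integral_of_dominated_convergence (μ := volume.restrict (Set.Ioi T))
    (F := fun (n : ℕ) (t : ℝ) => (z : ℂ) ^ n *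
      ((t : ℂ) ^ (-1 - 2 * s) * (1 - (T : ℂ) ^ 2 / (t : ℂ) ^ 2) ^ n))
    (f := fun t : ℝ => ((A : ℂ) ^ 2 + (T : ℂ) ^ 2) / (T : ℂ) ^ 2 *
      ((t : ℂ) ^ (1 - 2 * s) / ((A : ℂ) ^ 2 + (t : ℂ) ^ 2)))
    (fun n t => z ^ n * t ^ (-1 - 2 * s).re)
    (fun n => (aestronglyMeasurable_cpow_mul_one_sub_pow hT _ n).const_mul _)
    (fun n => by
      filter_upwards [ae_restrict_mem measurableSet_Ioi] with t ht
      rw [norm_mul, norm_pow, hzn]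
      gcongr
      exact norm_cpow_mul_one_sub_pow_le hT ht _ n)
    (Filter.Eventually.of_forall fun t => (summable_geometric_of_lt_one hz0 hz1).mul_right _)
    (by
      simp only [tsum_mul_right]
      exact (integrableOn_Ioi_rpow_of_lt ha hT).const_mul _)
    (by
      filter_upwards [ae_restrict_mem measurableSet_Ioi] with t ht
      have ht0 : 0 < t := hT.trans ht
      have htne : (t : ℂ) ≠ 0 := ofReal_ne_zero.mpr ht0.ne'
      have hAt : (A : ℂ) ^ 2 + (t : ℂ) ^ 2 ≠ 0 := by
        exact_mod_cast (by positivity : A ^ 2 + t ^ 2 ≠ 0)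
      have hr : ‖(z : ℂ) * (1 - (T : ℂ) ^ 2 / (t : ℂ) ^ 2)‖ < 1 := by
        rw [norm_mul, hzn]
        exact (mul_le_of_le_one_right hz0 (norm_one_sub_sq_div_sq_le_one hT ht)).trans_lt hz1
      have hg := (hasSum_geometric_of_norm_lt_one hr).mul_left ((t : ℂ) ^ (-1 - 2 * s))
      have hpow : (t : ℂ) ^ (1 - 2 * s) = (t : ℂ) ^ (-1 - 2 * s) * (t : ℂ) ^ 2 := by
        rw [← cpow_ofNat, ← cpow_add _ _ htne]
        ring_nf
      have hq : 1 - (z : ℂ) * (1 - (T : ℂ) ^ 2 / (t : ℂ) ^ 2) =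
          (T : ℂ) ^ 2 * ((A : ℂ) ^ 2 + (t : ℂ) ^ 2) /
            (((A : ℂ) ^ 2 + (T : ℂ) ^ 2) * (t : ℂ) ^ 2) := by
        rw [hzc]
        field_simp
        ring
      convert hg using 1
      · rfl
      · funext n
        rw [mul_pow]
        ring
      · rw [hq, hpow]
        field_simp)
  simp only [integral_const_mul, integral_cpow_mul_one_sub_pow hT hs] at hsum
  have hF : hypFC 1 1 (s + 1) (z : ℂ) =
      ∑' n : ℕ, (z : ℂ) ^ n * (n.factorial / (ascPochhammer ℂ n).eval (s + 1)) := by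
    unfold hypFC
    refine tsum_congr fun n => ?_
    have hp := ascPochhammer_eval_add_one_ne_zero hs n
    have hf : (n.factorial : ℂ) ≠ 0 := by exact_mod_cast n.factorial_ne_zero
    rw [ascPochhammer_eval_one]
    field_simp
  have htsum : (T : ℂ) ^ (-2 * s) / (2 * s) * hypFC 1 1 (s + 1) (z : ℂ) =
      ((A : ℂ) ^ 2 + (T : ℂ) ^ 2) / (T : ℂ) ^ 2 *
        ∫ t in Set.Ioi T, (t : ℂ) ^ (1 - 2 * s) / ((A : ℂ) ^ 2 + (t : ℂ) ^ 2) := by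
    rw [hF, ← tsum_mul_left, ← hsum.tsum_eq]
    exact tsum_congr fun n => by ring
  have hpow : (T : ℂ) ^ (2 - 2 * s) = (T : ℂ) ^ (-2 * s) * (T : ℂ) ^ 2 := by
    rw [← cpow_ofNat, ← cpow_add _ _ hTne]
    ring_nf
  rw [hpow]
  field_simp at htsum ⊢
  linear_combination -htsum
end

section
/- For every real u with 0 ≤ u < 1, log(1 + √(1−u)) = log 2 − (1/√π) · ∑_{n=1}^∞ (Γ(n + 1/2)/(n! · 2n)) · uⁿ, where Γ is the Gamma function; in particular the series on the right converges for 0 ≤ u < 1. -/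
open Real

/-- The coefficients of the binomial series of `(1 - x) ^ (-1/2)` in terms of the Gamma function. -/
theorem choose_half_eq_Gamma (n : ℕ) :
    √π * Ring.choose (1 / 2 + (n : ℝ) - 1) n = Real.Gamma (n + 1 / 2) / n.factorial := by
  have key : √π * (ascPochhammer ℝ n).eval (1 / 2) = Real.Gamma (n + 1 / 2) := by
    induction n with
    | zero => simp [← Real.Gamma_one_half_eq]
    | succ n ih =>
      rw [ascPochhammer_succ_eval, ← mul_assoc, ih, Nat.cast_succ,
        show (n : ℝ) + 1 + 1 / 2 = n + 1 / 2 + 1 by ring, Real.Gamma_add_one (by positivity)]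
      ring
  have h := Ring.factorial_nsmul_multichoose_eq_ascPochhammer (1 / 2 : ℝ) n
  rw [Polynomial.ascPochhammer_smeval_eq_eval, nsmul_eq_mul, Ring.multichoose_eq] at h
  rw [← key, ← h]
  field_simp

theorem hasSum_Gamma_half_mul_pow {x : ℝ} (hx : |x| < 1) :
    HasSum (fun n : ℕ => Real.Gamma (n + 1 / 2) / n.factorial * x ^ n) (√π / √(1 - x)) := by
  have h := (Real.one_div_one_sub_rpow_hasFPowerSeriesOnBall_zero (1 / 2)).hasSum
    (y := x) (by simpa [enorm_eq_nnnorm] using! hx)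
  simp only [zero_add, FormalMultilinearSeries.ofScalars_apply_eq, smul_eq_mul,
    ← Real.sqrt_eq_rpow] at h
  have h' := h.mul_left (√π)
  simpa only [← mul_assoc, choose_half_eq_Gamma, mul_one_div] using h'

theorem hasSum_Gamma_half_succ_mul_pow {x : ℝ} (hx : |x| < 1) :
    HasSum (fun n : ℕ => Real.Gamma ((n : ℝ) + 1 + 1 / 2) / (n + 1).factorial * x ^ (n + 1))
      (√π / √(1 - x) - √π) := by
  have h := (hasSum_nat_add_iff' 1).2 (hasSum_Gamma_half_mul_pow hx)
  simpa [← one_div, Real.Gamma_one_half_eq] using h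

/-- Termwise derivative of the series for `log (1 + √(1 - x))`. -/
theorem hasSum_Gamma_half_succ_mul_pow_half {x : ℝ} (hx : |x| < 1) :
    HasSum (fun n : ℕ => Real.Gamma ((n : ℝ) + 1 + 1 / 2) / (n + 1).factorial / 2 * x ^ n)
      (√π / (2 * √(1 - x) * (1 + √(1 - x)))) := by
  rcases eq_or_ne x 0 with rfl | h0
  · convert hasSum_single (0 : ℕ) ?_ using 1
    · have : Real.Gamma (1 + 1 / 2) = 1 / 2 * √π := by
        rw [add_comm, Real.Gamma_add_one (by norm_num), Real.Gamma_one_half_eq]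
      simp only [Nat.cast_zero, zero_add, this]
      norm_num
      ring
    · intro n hn
      simp [hn]
  · have hs : 0 < √(1 - x) := Real.sqrt_pos.2 (by linarith [(abs_lt.1 hx).2])
    have hsq : √(1 - x) ^ 2 = 1 - x := Real.sq_sqrt (by linarith [(abs_lt.1 hx).2])
    have hval : (√π / √(1 - x) - √π) / (2 * x) = √π / (2 * √(1 - x) * (1 + √(1 - x))) := by
      have hx' : x = (1 - √(1 - x)) * (1 + √(1 - x)) := by linear_combination hsq
      have h1 : 1 - √(1 - x) ≠ 0 := fun h => h0 (by rw [hx', h, zero_mul])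
      generalize √(1 - x) = s at *
      subst hx'
      field_simp
    rw [← hval]
    convert! (hasSum_Gamma_half_succ_mul_pow hx).div_const (2 * x) using 2 with n
    field_simp
    ring

theorem hasDerivAt_log_one_add_sqrt_one_sub {x : ℝ} (hx : x < 1) :
    HasDerivAt (fun y => Real.log (1 + √(1 - y))) (-(1 / (2 * √(1 - x) * (1 + √(1 - x))))) x := by
  have hs : 0 < √(1 - x) := Real.sqrt_pos.2 (by linarith)
  have h := ((((hasDerivAt_id x).const_sub 1).sqrt (by simp; linarith)).const_add 1).log
    (by simp; positivity)
  refine h.congr_deriv ?_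
  simp only [id]
  field_simp

theorem summable_Gamma_half_div_mul_pow {u : ℝ} (hu0 : 0 ≤ u) (hu1 : u < 1) :
    Summable (fun n : ℕ => Real.Gamma ((n : ℝ) + 1 + 1 / 2) /
      ((Nat.factorial (n + 1)) * (2 * ((n : ℝ) + 1))) * u ^ (n + 1)) := by
  refine Summable.of_nonneg_of_le (fun n => ?_) (fun n => ?_)
    (hasSum_Gamma_half_succ_mul_pow (x := u) (by rwa [abs_of_nonneg hu0])).summable
  · have := Real.Gamma_pos_of_pos (s := (n : ℝ) + 1 + 1 / 2) (by positivity)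
    positivity
  · have := Real.Gamma_pos_of_pos (s := (n : ℝ) + 1 + 1 / 2) (by positivity)
    gcongr
    exact le_mul_of_one_le_right (by positivity) (by linarith [(n.cast_nonneg : (0 : ℝ) ≤ n)])

theorem hasDerivAt_tsum_Gamma_half {x : ℝ} (hx : |x| < 1) :
    HasDerivAt (fun y => ∑' n : ℕ, Real.Gamma ((n : ℝ) + 1 + 1 / 2) /
      ((Nat.factorial (n + 1)) * (2 * ((n : ℝ) + 1))) * y ^ (n + 1))
      (√π / (2 * √(1 - x) * (1 + √(1 - x)))) x := by
  obtain ⟨r, hxr, hr1⟩ := exists_between hx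
  have hr0 : 0 < r := (abs_nonneg x).trans_lt hxr
  rw [← (hasSum_Gamma_half_succ_mul_pow_half hx).tsum_eq]
  refine hasDerivAt_tsum_of_isPreconnected (t := Set.Ioo (-r) r)
    (g := fun (n : ℕ) y => Real.Gamma ((n : ℝ) + 1 + 1 / 2) /
      ((Nat.factorial (n + 1)) * (2 * ((n : ℝ) + 1))) * y ^ (n + 1))
    (g' := fun (n : ℕ) y => Real.Gamma ((n : ℝ) + 1 + 1 / 2) / (n + 1).factorial / 2 * y ^ n)
    (y₀ := 0)
    (hasSum_Gamma_half_succ_mul_pow_half (x := r) (by rwa [abs_of_pos hr0])).summable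
    isOpen_Ioo isPreconnected_Ioo (fun n y _ => ?_) (fun n y hy => ?_)
    (by simpa using hr0)
    (summable_Gamma_half_div_mul_pow le_rfl one_pos) (abs_lt.1 hxr)
  · refine ((hasDerivAt_pow (n + 1) y).const_mul _).congr_deriv ?_
    simp only [Nat.add_sub_cancel, Nat.cast_succ]
    field_simp
  · have := Real.Gamma_pos_of_pos (s := (n : ℝ) + 1 + 1 / 2) (by positivity)
    rw [norm_mul, norm_pow, Real.norm_of_nonneg (by positivity), Real.norm_eq_abs]
    gcongr
    exact (abs_lt.2 hy).le

/-- For `0 ≤ u < 1`,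
`log(1 + √(1-u)) = log 2 - (1/√π) ∑_{n≥1} (Γ(n+1/2)/(n! · 2n)) uⁿ`,
and in particular the series converges. -/
theorem stmt10 (u : ℝ) (hu0 : 0 ≤ u) (hu1 : u < 1) :
    Summable (fun n : ℕ =>
        Real.Gamma ((n : ℝ) + 1 + 1 / 2) /
          ((Nat.factorial (n + 1)) * (2 * ((n : ℝ) + 1))) * u ^ (n + 1)) ∧
    Real.log (1 + Real.sqrt (1 - u)) =
      Real.log 2 - (1 / Real.sqrt π) *
        ∑' n : ℕ, Real.Gamma ((n : ℝ) + 1 + 1 / 2) /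
          ((Nat.factorial (n + 1)) * (2 * ((n : ℝ) + 1))) * u ^ (n + 1) := by
  refine ⟨summable_Gamma_half_div_mul_pow hu0 hu1, ?_⟩
  have hderiv : ∀ x ∈ Set.Ioo (-1 : ℝ) 1, HasDerivAt (fun y => Real.log (1 + √(1 - y)) +
      1 / √π * ∑' n : ℕ, Real.Gamma ((n : ℝ) + 1 + 1 / 2) /
        ((Nat.factorial (n + 1)) * (2 * ((n : ℝ) + 1))) * y ^ (n + 1)) 0 x := by
    intro x hx
    refine ((hasDerivAt_log_one_add_sqrt_one_sub hx.2).add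
      ((hasDerivAt_tsum_Gamma_half (abs_lt.2 hx)).const_mul (1 / √π))).congr_deriv ?_
    have : √π ≠ 0 := (Real.sqrt_pos.2 Real.pi_pos).ne'
    field_simp
    ring
  have hconst := isOpen_Ioo.is_const_of_deriv_eq_zero isPreconnected_Ioo
    (fun x hx => (hderiv x hx).differentiableAt.differentiableWithinAt)
    (fun x hx => (hderiv x hx).deriv) (x := u) (y := 0) ⟨by linarith, hu1⟩ (by norm_num)
  norm_num [-one_div] at hconst
  linarith
end

section
/- Let c > 0 be real, let θ ∈ (0, π/2), and let s be a complex number with Re s > 1. Then ∫_0^∞ (c + r²·e^{2iθ})^{−s} · r dr = e^{−2iθ} · c^{1−s} / (2(s−1)), where z^w = exp(w · Log z) is the principal complex power (note that c + r²e^{2iθ} has nonnegative imaginary part and never lies on the closed negative real axis). Consequently ∫_0^∞ (c + r²e^{2iθ})^{−s}·r·e^{2iθ} dr = ∫_0^∞ (c + r²e^{−2iθ})^{−s}·r·e^{−2iθ} dr, i.e. the contour integral of (c − t²)^{−s}·t over the rotated wedge contour iγ_{θ,±} vanishes. -/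
open Real Complex MeasureTheory

lemma add_sq_mul_mem_slitPlane {c : ℝ} (hc : 0 < c) {w : ℂ} (hw : w.im ≠ 0) (r : ℝ) :
    (c : ℂ) + (r : ℂ) ^ 2 * w ∈ slitPlane := by
  rw [mem_slitPlane_iff]
  rcases eq_or_ne r 0 with rfl | hr
  · left; simpa using hc
  · right
    rw [← ofReal_pow, add_im, ofReal_im, im_ofReal_mul, zero_add]
    exact mul_ne_zero (pow_ne_zero 2 hr) hw

lemma norm_add_sq_mul_cpow_le (c : ℝ) {w : ℂ} (hw : w.im ≠ 0) {a : ℂ} (ha : a.re ≤ 0)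
    {r : ℝ} (hr : 0 < r) :
    ‖((c : ℂ) + (r : ℂ) ^ 2 * w) ^ a‖ ≤
      Real.exp (π * |a.im|) * |w.im| ^ a.re * r ^ (2 * a.re) := by
  set z : ℂ := (c : ℂ) + (r : ℂ) ^ 2 * w with hz
  have him : z.im = r ^ 2 * w.im := by
    rw [hz, ← ofReal_pow, add_im, ofReal_im, im_ofReal_mul, zero_add]
  have hw' : 0 < |w.im| := abs_pos.mpr hw
  have hle : |w.im| * r ^ 2 ≤ ‖z‖ := by
    have h := abs_im_le_norm z
    rwa [him, abs_mul, abs_of_pos (by positivity : 0 < r ^ 2), mul_comm] at h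
  have hexp : -(arg z * a.im) ≤ π * |a.im| := by
    refine (neg_le_abs _).trans ?_
    rw [abs_mul]
    gcongr
    exact abs_arg_le_pi z
  calc ‖z ^ a‖ ≤ ‖z‖ ^ a.re / Real.exp (arg z * a.im) := norm_cpow_le z a
    _ = Real.exp (-(arg z * a.im)) * ‖z‖ ^ a.re := by rw [Real.exp_neg, div_eq_inv_mul]
    _ ≤ Real.exp (π * |a.im|) * (|w.im| * r ^ 2) ^ a.re := by
      gcongr ?_ * ?_
      · exact Real.exp_le_exp.mpr hexp
      · exact Real.rpow_le_rpow_of_nonpos (by positivity) hle ha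
    _ = Real.exp (π * |a.im|) * |w.im| ^ a.re * r ^ (2 * a.re) := by
      rw [Real.mul_rpow hw'.le (by positivity), Real.rpow_mul hr.le, Real.rpow_two, mul_assoc]

lemma integrableOn_Ioi_add_sq_mul_cpow {c : ℝ} (hc : 0 < c) {w : ℂ} (hw : w.im ≠ 0)
    {s : ℂ} (hs : 1 < s.re) :
    IntegrableOn (fun r : ℝ ↦ ((c : ℂ) + (r : ℂ) ^ 2 * w) ^ (-s) * (r : ℂ)) (Set.Ioi 0) := by
  have hcont : Continuous fun r : ℝ ↦ ((c : ℂ) + (r : ℂ) ^ 2 * w) ^ (-s) * (r : ℂ) :=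
    (Continuous.cpow (by fun_prop) continuous_const
      (add_sq_mul_mem_slitPlane hc hw)).mul continuous_ofReal
  rw [← Set.Ioc_union_Ioi_eq_Ioi zero_le_one]
  refine IntegrableOn.union (hcont.continuousOn.integrableOn_Icc.mono_set
    Set.Ioc_subset_Icc_self) ?_
  refine Integrable.mono' ((integrableOn_Ioi_rpow_of_lt (a := 2 * (-s).re + 1)
    (by rw [neg_re]; linarith) one_pos).const_mul
    (Real.exp (π * |(-s).im|) * |w.im| ^ (-s).re)) hcont.aestronglyMeasurable ?_
  filter_upwards [ae_restrict_mem measurableSet_Ioi] with r hr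
  have hr0 : 0 < r := one_pos.trans hr
  rw [norm_mul, norm_real, Real.norm_of_nonneg hr0.le, Real.rpow_add_one hr0.ne', ← mul_assoc]
  gcongr
  exact norm_add_sq_mul_cpow_le c hw (by rw [neg_re]; linarith) hr0

lemma integral_Ioi_add_sq_mul_cpow {c : ℝ} (hc : 0 < c) {w : ℂ} (hw : w.im ≠ 0)
    {s : ℂ} (hs : 1 < s.re) :
    ∫ r in Set.Ioi (0 : ℝ), ((c : ℂ) + (r : ℂ) ^ 2 * w) ^ (-s) * (r : ℂ) =
      w⁻¹ * (c : ℂ) ^ (1 - s) / (2 * (s - 1)) := by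
  have hw0 : w ≠ 0 := by rintro rfl; simp at hw
  have hs1 : s - 1 ≠ 0 := fun h ↦ by
    have := congrArg re h
    simp only [sub_re, one_re, zero_re] at this
    linarith
  have hs1' : 1 - s ≠ 0 := by rw [← neg_sub]; exact neg_ne_zero.mpr hs1
  have hderiv : ∀ r ∈ Set.Ici (0 : ℝ), HasDerivAt
      (fun r : ℝ ↦ ((c : ℂ) + (r : ℂ) ^ 2 * w) ^ (1 - s) / (2 * w * (1 - s)))
      (((c : ℂ) + (r : ℂ) ^ 2 * w) ^ (-s) * (r : ℂ)) r := by
    intro r _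
    have h := (((((hasDerivAt_id (r : ℂ)).pow 2).mul_const w).const_add (c : ℂ)).cpow_const
      (c := 1 - s) (add_sq_mul_mem_slitPlane hc hw r)).div_const (2 * w * (1 - s))
    convert! h.comp_ofReal using 1
    rw [show 1 - s - 1 = -s by ring]
    simp only [id, Pi.pow_apply]
    field_simp
    push_cast
    ring
  have hlim : Filter.Tendsto
      (fun r : ℝ ↦ ((c : ℂ) + (r : ℂ) ^ 2 * w) ^ (1 - s) / (2 * w * (1 - s)))
      Filter.atTop (nhds 0) := by
    rw [← zero_div (2 * w * (1 - s))]
    refine Filter.Tendsto.div_const ?_ _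
    have hre : (1 - s).re < 0 := by rw [sub_re, one_re]; linarith
    have hpow := (tendsto_rpow_neg_atTop (y := -(2 * (1 - s).re)) (by linarith)).const_mul
      (Real.exp (π * |(1 - s).im|) * |w.im| ^ (1 - s).re)
    rw [neg_neg, mul_zero] at hpow
    refine squeeze_zero_norm' ?_ hpow
    filter_upwards [Filter.eventually_gt_atTop 0] with r hr
    exact norm_add_sq_mul_cpow_le c hw hre.le hr
  rw [integral_Ioi_of_hasDerivAt_of_tendsto' hderiv
    (integrableOn_Ioi_add_sq_mul_cpow hc hw hs) hlim]
  simp only [ofReal_zero, ne_eq, OfNat.ofNat_ne_zero, not_false_eq_true, zero_pow, zero_mul,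
    add_zero]
  rw [← neg_sub s 1]
  field_simp
  ring

/-- Evaluation of `∫₀^∞ (c + r² e^{2iθ})^{-s} r dr` for `c > 0`, `θ ∈ (0, π/2)`
and `Re s > 1` (principal complex powers), and the resulting vanishing of the
contour integral of `(c - t²)^{-s} t` over the wedge contour `i γ_{θ,±}`. -/
theorem stmt11 (c : ℝ) (hc : 0 < c) (θ : ℝ) (hθ : θ ∈ Set.Ioo 0 (π / 2))
    (s : ℂ) (hs : 1 < s.re) :
    (∫ r in Set.Ioi (0:ℝ),
        ((c : ℂ) + (r : ℂ) ^ 2 * Complex.exp (2 * Complex.I * θ)) ^ (-s) * (r : ℂ)) =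
      Complex.exp (-2 * Complex.I * θ) * (c : ℂ) ^ (1 - s) / (2 * (s - 1)) ∧
    (∫ r in Set.Ioi (0:ℝ),
        ((c : ℂ) + (r : ℂ) ^ 2 * Complex.exp (2 * Complex.I * θ)) ^ (-s) * (r : ℂ) *
          Complex.exp (2 * Complex.I * θ)) =
      ∫ r in Set.Ioi (0:ℝ),
        ((c : ℂ) + (r : ℂ) ^ 2 * Complex.exp (-2 * Complex.I * θ)) ^ (-s) * (r : ℂ) *
          Complex.exp (-2 * Complex.I * θ) := by
  have hsin : 0 < Real.sin (2 * θ) :=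
    Real.sin_pos_of_pos_of_lt_pi (by linarith [hθ.1]) (by linarith [hθ.2])
  have him : (Complex.exp (2 * I * θ)).im ≠ 0 := by
    rw [show 2 * I * (θ : ℂ) = ((2 * θ : ℝ) : ℂ) * I by push_cast; ring, exp_ofReal_mul_I_im]
    exact hsin.ne'
  have him' : (Complex.exp (-2 * I * θ)).im ≠ 0 := by
    rw [show -2 * I * (θ : ℂ) = ((-(2 * θ) : ℝ) : ℂ) * I by push_cast; ring,
      exp_ofReal_mul_I_im, Real.sin_neg]
    exact neg_ne_zero.mpr hsin.ne'
  have hinv : (Complex.exp (2 * I * θ))⁻¹ = Complex.exp (-2 * I * θ) := by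
    rw [← Complex.exp_neg]; congr 1; ring
  refine ⟨by rw [integral_Ioi_add_sq_mul_cpow hc him hs, hinv], ?_⟩
  rw [integral_mul_const, integral_mul_const, integral_Ioi_add_sq_mul_cpow hc him hs,
    integral_Ioi_add_sq_mul_cpow hc him' hs]
  have h₁ := Complex.exp_ne_zero (2 * I * θ)
  have h₂ := Complex.exp_ne_zero (-2 * I * θ)
  field_simp
end

section
/- Let α ∈ ℝ, δ > 0, a > 0 and μ ≥ 0. The function G(s) = −(sin(πs)/π) · (4μ+1)^{−(1+δ)s} · (2δs−1)^{−1} · (4πa)^{2δs} · α · ((2δs−2)/(δs)) · Γ(1+δs) · Γ(1−δs), defined for complex s ≠ 0 in a punctured neighborhood of 0, extends to a holomorphic function on a neighborhood of 0, with G(0) = −2α/δ and G'(0) = −(2α/δ)·(δ − (1+δ)·log(4μ+1) + 2δ·log(4πa)). -/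
open Real Complex

/-- The even function `Γ(1+s) Γ(1-s)`, equal to `π s / sin (π s)` away from the integers. -/
noncomputable def gammaPair (s : ℂ) : ℂ := Complex.Gamma (1 + s) * Complex.Gamma (1 - s)

lemma gammaPair_zero : gammaPair 0 = 1 := by
  simp [gammaPair]

lemma one_add_ne_neg_nat_of_norm_lt_one {s : ℂ} (hs : ‖s‖ < 1) (m : ℕ) : 1 + s ≠ -m := by
  intro h
  have hre := congrArg Complex.re h
  simp only [Complex.add_re, Complex.one_re, Complex.neg_re, Complex.natCast_re] at hre
  have h1 := (abs_le.mp (Complex.abs_re_le_norm s)).1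
  have h2 : (0 : ℝ) ≤ m := m.cast_nonneg
  linarith

lemma one_sub_ne_neg_nat_of_norm_lt_one {s : ℂ} (hs : ‖s‖ < 1) (m : ℕ) : 1 - s ≠ -m := by
  simpa [sub_eq_add_neg] using
    one_add_ne_neg_nat_of_norm_lt_one (s := -s) (by rwa [norm_neg]) m

lemma differentiableAt_gammaPair {s : ℂ} (hs : ‖s‖ < 1) : DifferentiableAt ℂ gammaPair s := by
  have h1 := Complex.differentiableAt_Gamma (1 + s) (one_add_ne_neg_nat_of_norm_lt_one hs)
  have h2 := Complex.differentiableAt_Gamma (1 - s) (one_sub_ne_neg_nat_of_norm_lt_one hs)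
  exact (h1.comp s (by fun_prop)).mul (h2.comp s (by fun_prop))

lemma gammaPair_ne_zero {s : ℂ} (hs : ‖s‖ < 1) : gammaPair s ≠ 0 :=
  mul_ne_zero (Complex.Gamma_ne_zero (one_add_ne_neg_nat_of_norm_lt_one hs))
    (Complex.Gamma_ne_zero (one_sub_ne_neg_nat_of_norm_lt_one hs))

lemma hasDerivAt_gammaPair_zero : HasDerivAt gammaPair 0 0 := by
  have h := (differentiableAt_gammaPair (s := 0) (by simp)).hasDerivAt
  have heven : (fun s => gammaPair (-s)) = gammaPair := by
    funext s
    simp only [gammaPair, sub_neg_eq_add, ← sub_eq_add_neg]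
    ring
  have hd := deriv_comp_neg gammaPair 0
  rw [heven, neg_zero] at hd
  rwa [self_eq_neg.mp hd] at h

lemma sin_pi_mul_div_pi {s : ℂ} (h0 : s ≠ 0) :
    Complex.sin (π * s) / π = s * (gammaPair s)⁻¹ := by
  have hG : gammaPair s = s * (π / Complex.sin (π * s)) := by
    rw [gammaPair, add_comm, Complex.Gamma_add_one s h0, mul_assoc,
      Complex.Gamma_mul_Gamma_one_sub]
  rw [hG, mul_inv, inv_div, ← mul_assoc, mul_inv_cancel₀ h0, one_mul]

/-- The function
`G(s) = -(sin(πs)/π) (4μ+1)^{-(1+δ)s} (2δs-1)⁻¹ (4πa)^{2δs} α ((2δs-2)/(δs))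
  Γ(1+δs) Γ(1-δs)`, defined for `s ≠ 0` near `0`, extends holomorphically to a
neighborhood of `0` with `G(0) = -2α/δ` and
`G'(0) = -(2α/δ)(δ - (1+δ) log(4μ+1) + 2δ log(4πa))`. -/
theorem stmt12 (α δ a μ : ℝ) (hδ : 0 < δ) (ha : 0 < a) (hμ : 0 ≤ μ) :
    ∃ (U : Set ℂ) (G : ℂ → ℂ), IsOpen U ∧ (0 : ℂ) ∈ U ∧ DifferentiableOn ℂ G U ∧
      (∀ s ∈ U, s ≠ 0 →
        G s = -(Complex.sin (π * s) / π) *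
            ((4 * μ + 1 : ℝ) : ℂ) ^ (-(1 + (δ : ℂ)) * s) * (2 * δ * s - 1)⁻¹ *
            ((4 * π * a : ℝ) : ℂ) ^ (2 * (δ : ℂ) * s) * (α : ℂ) *
            ((2 * δ * s - 2) / (δ * s)) *
            Complex.Gamma (1 + δ * s) * Complex.Gamma (1 - δ * s)) ∧
      G 0 = ((-2 * α / δ : ℝ) : ℂ) ∧
      deriv G 0 = ((-(2 * α / δ) *
        (δ - (1 + δ) * Real.log (4 * μ + 1) + 2 * δ * Real.log (4 * π * a)) : ℝ) : ℂ) := by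
  have hδ' : (δ : ℂ) ≠ 0 := by exact_mod_cast hδ.ne'
  have hb : ((4 * μ + 1 : ℝ) : ℂ) ≠ 0 := by
    exact_mod_cast (by positivity : (4 * μ + 1 : ℝ) ≠ 0)
  have hc : ((4 * π * a : ℝ) : ℂ) ≠ 0 := by
    exact_mod_cast (by positivity : (4 * π * a : ℝ) ≠ 0)
  have hlogb := Complex.ofReal_log (by positivity : (0 : ℝ) ≤ 4 * μ + 1)
  have hlogc := Complex.ofReal_log (by positivity : (0 : ℝ) ≤ 4 * π * a)
  generalize ((4 * μ + 1 : ℝ) : ℂ) = b at *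
  generalize ((4 * π * a : ℝ) : ℂ) = c at *
  have hδs {s : ℂ} (hs : ‖s‖ < 1 / (2 * δ)) : ‖2 * δ * s‖ < 1 := by
    rw [lt_div_iff₀ (by positivity)] at hs
    simp only [norm_mul, Complex.norm_ofNat, Complex.norm_real, Real.norm_of_nonneg hδ.le]
    linarith
  have hδs' {s : ℂ} (hs : ‖s‖ < 1 / (2 * δ)) : ‖δ * s‖ < 1 := by
    have h := hδs hs
    rw [mul_assoc, norm_mul, Complex.norm_ofNat] at h
    linarith [norm_nonneg ((δ : ℂ) * s)]
  have hden {s : ℂ} (hs : ‖s‖ < 1 / (2 * δ)) : 2 * δ * s - 1 ≠ 0 := by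
    intro h
    have h1 := hδs hs
    rw [sub_eq_zero.mp h, norm_one] at h1
    exact lt_irrefl _ h1
  refine ⟨Metric.ball 0 (min 1 (1 / (2 * δ))),
    fun s => -(gammaPair s)⁻¹ * b ^ (-(1 + (δ : ℂ)) * s) * (2 * δ * s - 1)⁻¹ *
      c ^ (2 * (δ : ℂ) * s) * α * ((2 * δ * s - 2) / δ) * gammaPair (δ * s),
    Metric.isOpen_ball, Metric.mem_ball_self (by positivity), ?_, ?_, ?_, ?_⟩
  · intro s hs
    rw [mem_ball_zero_iff, lt_min_iff] at hs
    have h1 := (differentiableAt_gammaPair hs.1).inv (gammaPair_ne_zero hs.1)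
    have h2 : DifferentiableAt ℂ (fun s => b ^ (-(1 + (δ : ℂ)) * s)) s :=
      DifferentiableAt.const_cpow (by fun_prop) (Or.inl hb)
    have h3 : DifferentiableAt ℂ (fun s : ℂ => (2 * δ * s - 1)⁻¹) s :=
      DifferentiableAt.inv (by fun_prop) (hden hs.2)
    have h4 : DifferentiableAt ℂ (fun s => c ^ (2 * (δ : ℂ) * s)) s :=
      DifferentiableAt.const_cpow (by fun_prop) (Or.inl hc)
    have h5 : DifferentiableAt ℂ (fun s : ℂ => (2 * δ * s - 2) / δ) s := by fun_prop
    have h6 : DifferentiableAt ℂ (fun s : ℂ => gammaPair (δ * s)) s :=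
      (differentiableAt_gammaPair (hδs' hs.2)).comp s (by fun_prop)
    exact ((((((h1.neg.mul h2).mul h3).mul h4).mul_const _).mul h5).mul
      h6).differentiableWithinAt
  · intro s hs h0
    rw [mem_ball_zero_iff, lt_min_iff] at hs
    rw [sin_pi_mul_div_pi h0, mul_assoc _ (Complex.Gamma _), ← gammaPair]
    field_simp
  · simp only [mul_zero, gammaPair_zero, Complex.cpow_zero]
    push_cast
    field_simp
    ring
  · have h1 := hasDerivAt_gammaPair_zero.inv (gammaPair_ne_zero (s := 0) (by simp))
    have hlin (k : ℂ) : HasDerivAt (fun s => k * s) k 0 := by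
      simpa using (hasDerivAt_id (0 : ℂ)).const_mul k
    have h2 := (hlin (-(1 + (δ : ℂ)))).const_cpow (c := b) (Or.inl hb)
    have h3 := ((hlin (2 * (δ : ℂ))).sub_const 1).inv (by simp)
    have h4 := (hlin (2 * (δ : ℂ))).const_cpow (c := c) (Or.inl hc)
    have h5 := ((hlin (2 * (δ : ℂ))).sub_const 2).div_const (δ : ℂ)
    have h6 : HasDerivAt (fun s => gammaPair (δ * s)) (0 * (δ : ℂ)) 0 :=
      HasDerivAt.comp (h₂ := gammaPair) 0 (by simpa using hasDerivAt_gammaPair_zero) (hlin δ)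
    have h := (((((h1.neg.mul h2).mul h3).mul h4).mul_const (α : ℂ)).mul h5).mul h6
    refine h.deriv.trans ?_
    simp only [Pi.mul_apply, Pi.neg_apply, Pi.inv_apply, mul_zero, gammaPair_zero,
      Complex.cpow_zero]
    push_cast [hlogb, hlogc]
    field_simp
    ring
end

section
/- Let α ∈ ℝ, δ > 0 and μ ≥ 0. The function s ↦ −2α · (sin(πs)/π) · (4μ+1)^{−s} · ζ(1 + 2δs), defined for complex s ≠ 0 in a punctured neighborhood of 0 (where ζ is the Riemann zeta function, with its simple pole at 1), extends to a holomorphic function G on a neighborhood of 0, with G(0) = −α/δ and G'(0) = −2αγ + (α/δ)·log(4μ+1), where γ is the Euler–Mascheroni constant. -/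
open Real Complex

/-- The entire function `w ↦ w ζ(1 + w)`, with the value `1` at the removable singularity `0`. -/
noncomputable def mulZetaOneAdd : ℂ → ℂ :=
  Function.update (fun w ↦ w * riemannZeta (1 + w)) 0 1

lemma mulZetaOneAdd_zero : mulZetaOneAdd 0 = 1 := by
  simp [mulZetaOneAdd]

lemma mulZetaOneAdd_of_ne_zero {w : ℂ} (hw : w ≠ 0) :
    mulZetaOneAdd w = w * riemannZeta (1 + w) := by
  simp [mulZetaOneAdd, hw]

lemma hasDerivAt_mulZetaOneAdd_zero :
    HasDerivAt mulZetaOneAdd (Real.eulerMascheroniConstant : ℂ) 0 := by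
  rw [hasDerivAt_iff_tendsto_slope]
  have hmap : Filter.Tendsto (fun w : ℂ ↦ 1 + w) (nhdsWithin 0 {0}ᶜ) (nhdsWithin 1 {1}ᶜ) := by
    refine tendsto_nhdsWithin_iff.mpr ⟨?_, ?_⟩
    · have h : ContinuousAt (fun w : ℂ ↦ 1 + w) 0 := by fun_prop
      simpa [ContinuousAt] using h.mono_left nhdsWithin_le_nhds
    · filter_upwards [self_mem_nhdsWithin] with w hw
      simpa using hw
  refine (tendsto_riemannZeta_sub_one_div.comp hmap).congr' ?_
  filter_upwards [self_mem_nhdsWithin] with w hw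
  have hw' : w ≠ 0 := hw
  simp only [Function.comp_apply, slope_def_field, mulZetaOneAdd_zero,
    mulZetaOneAdd_of_ne_zero hw', add_sub_cancel_left, sub_zero]
  field_simp

lemma differentiable_mulZetaOneAdd : Differentiable ℂ mulZetaOneAdd := by
  intro w
  rcases eq_or_ne w 0 with rfl | hw
  · exact hasDerivAt_mulZetaOneAdd_zero.differentiableAt
  · have hz : DifferentiableAt ℂ (fun w ↦ w * riemannZeta (1 + w)) w :=
      differentiableAt_id.mul <| DifferentiableAt.comp w
        (differentiableAt_riemannZeta (by simpa using hw)) (by fun_prop)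
    refine hz.congr_of_eventuallyEq ?_
    filter_upwards [isOpen_ne.mem_nhds hw] with z hz
    exact mulZetaOneAdd_of_ne_zero hz

lemma differentiable_dslope_sin : Differentiable ℂ (dslope Complex.sin 0) := by
  rw [← differentiableOn_univ, Complex.differentiableOn_dslope Filter.univ_mem]
  exact Complex.differentiable_sin.differentiableOn

lemma dslope_sin_zero : dslope Complex.sin 0 0 = 1 := by
  simp [dslope_same]

lemma dslope_sin_of_ne_zero {s : ℂ} (hs : s ≠ 0) :
    dslope Complex.sin 0 s = Complex.sin s / s := by
  simp [dslope_of_ne _ hs, slope_def_field]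

lemma hasDerivAt_dslope_sin_zero : HasDerivAt (dslope Complex.sin 0) 0 0 := by
  have heven : (fun s ↦ dslope Complex.sin 0 (-s)) = dslope Complex.sin 0 := by
    funext s
    rcases eq_or_ne s 0 with rfl | hs
    · simp
    · rw [dslope_sin_of_ne_zero hs, dslope_sin_of_ne_zero (neg_ne_zero.mpr hs), Complex.sin_neg,
        neg_div_neg_eq]
  have hd := deriv_comp_neg (dslope Complex.sin 0) 0
  rw [heven, neg_zero] at hd
  simpa [self_eq_neg.mp hd] using (differentiable_dslope_sin 0).hasDerivAt

/-- The function `s ↦ -2α (sin(πs)/π) (4μ+1)^{-s} ζ(1+2δs)`, defined for `s ≠ 0`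
near `0`, extends holomorphically to a neighborhood of `0` with `G(0) = -α/δ`
and `G'(0) = -2αγ + (α/δ) log(4μ+1)`. -/
theorem stmt13 (α δ μ : ℝ) (hδ : 0 < δ) (hμ : 0 ≤ μ) :
    ∃ (U : Set ℂ) (G : ℂ → ℂ), IsOpen U ∧ (0 : ℂ) ∈ U ∧ DifferentiableOn ℂ G U ∧
      (∀ s ∈ U, s ≠ 0 →
        G s = -2 * (α : ℂ) * (Complex.sin (π * s) / π) *
            ((4 * μ + 1 : ℝ) : ℂ) ^ (-s) * riemannZeta (1 + 2 * δ * s)) ∧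
      G 0 = ((-α / δ : ℝ) : ℂ) ∧
      deriv G 0 = ((-2 * α * Real.eulerMascheroniConstant
        + (α / δ) * Real.log (4 * μ + 1) : ℝ) : ℂ) := by
  have hδ' : (δ : ℂ) ≠ 0 := by exact_mod_cast hδ.ne'
  have hπ : (π : ℂ) ≠ 0 := by exact_mod_cast Real.pi_ne_zero
  have hc : 0 < 4 * μ + 1 := by positivity
  have hc' : ((4 * μ + 1 : ℝ) : ℂ) ≠ 0 := by exact_mod_cast hc.ne'
  have hlin (a s : ℂ) : HasDerivAt (fun s : ℂ ↦ a * s) a s := by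
    simpa using (hasDerivAt_id s).const_mul a
  have hpow (s : ℂ) := (hasDerivAt_neg s).const_cpow (c := ((4 * μ + 1 : ℝ) : ℂ)) (Or.inl hc')
  refine ⟨Set.univ, fun s ↦ -(α / δ : ℂ) * (dslope Complex.sin 0 (π * s) *
    ((4 * μ + 1 : ℝ) : ℂ) ^ (-s) * mulZetaOneAdd (2 * δ * s)), isOpen_univ, Set.mem_univ _,
    ?_, ?_, ?_, ?_⟩
  · refine Differentiable.differentiableOn (Differentiable.const_mul ?_ _)
    refine ((differentiable_dslope_sin.comp fun s ↦ (hlin π s).differentiableAt).mul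
      fun s ↦ (hpow s).differentiableAt).mul
      (differentiable_mulZetaOneAdd.comp fun s ↦ (hlin (2 * δ) s).differentiableAt)
  · intro s _ hs
    simp only
    rw [dslope_sin_of_ne_zero (mul_ne_zero hπ hs),
      mulZetaOneAdd_of_ne_zero (mul_ne_zero (mul_ne_zero two_ne_zero hδ') hs)]
    field_simp
  · simp [mulZetaOneAdd_zero, neg_div]
  · have hsin : HasDerivAt (fun s : ℂ ↦ dslope Complex.sin 0 (π * s)) (0 * π) 0 :=
      HasDerivAt.comp (h₂ := dslope Complex.sin 0) 0
        (by simpa using hasDerivAt_dslope_sin_zero) (hlin π 0)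
    have hzeta : HasDerivAt (fun s : ℂ ↦ mulZetaOneAdd (2 * δ * s))
        (Real.eulerMascheroniConstant * (2 * δ)) 0 :=
      HasDerivAt.comp (h₂ := mulZetaOneAdd) 0
        (by simpa using hasDerivAt_mulZetaOneAdd_zero) (hlin (2 * δ) 0)
    have hG := ((hsin.mul (hpow 0)).mul hzeta).const_mul (-(α / δ : ℂ))
    refine hG.deriv.trans ?_
    rw [← Complex.ofReal_log hc.le]
    simp only [Pi.mul_apply, mul_zero, neg_zero, Complex.cpow_zero, dslope_sin_zero,
      mulZetaOneAdd_zero]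
    push_cast
    field_simp
    ring
end

section
/- Let a > 0, δ > 0 and μ ≥ 0. The function Z(s) = −2 · (sin(πs)/π) · (4μ+1)^{−s} · (log(4πa)·ζ(2δs) − ζ'(2δs)) is holomorphic in a neighborhood of s = 0, satisfies Z(0) = 0, and Z'(0) = log(2a) = log 2 + log a. -/
open Real Complex

lemma differentiableAt_deriv_riemannZeta {z : ℂ} (hz : z ≠ 1) :
    DifferentiableAt ℂ (deriv riemannZeta) z := by
  have h : DifferentiableOn ℂ riemannZeta {1}ᶜ := fun w hw =>
    (differentiableAt_riemannZeta hw).differentiableWithinAt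
  exact (h.deriv isOpen_compl_singleton).differentiableAt
    (isOpen_compl_singleton.mem_nhds hz)

/-- The function `Z(s) = -2 (sin(πs)/π) (4μ+1)^{-s} (log(4πa) ζ(2δs) - ζ'(2δs))`
is holomorphic near `0`, vanishes at `0`, and `Z'(0) = log 2 + log a`. -/
theorem stmt15 (a δ μ : ℝ) (ha : 0 < a) (hδ : 0 < δ) (hμ : 0 ≤ μ) :
    ∃ U : Set ℂ, IsOpen U ∧ (0 : ℂ) ∈ U ∧
      DifferentiableOn ℂ
        (fun s : ℂ => -2 * (Complex.sin (π * s) / π) * ((4 * μ + 1 : ℝ) : ℂ) ^ (-s) *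
          (((Real.log (4 * π * a) : ℝ) : ℂ) * riemannZeta (2 * δ * s)
            - deriv riemannZeta (2 * δ * s))) U ∧
    (fun s : ℂ => -2 * (Complex.sin (π * s) / π) * ((4 * μ + 1 : ℝ) : ℂ) ^ (-s) *
          (((Real.log (4 * π * a) : ℝ) : ℂ) * riemannZeta (2 * δ * s)
            - deriv riemannZeta (2 * δ * s))) 0 = 0 ∧
    deriv (fun s : ℂ => -2 * (Complex.sin (π * s) / π) * ((4 * μ + 1 : ℝ) : ℂ) ^ (-s) *
          (((Real.log (4 * π * a) : ℝ) : ℂ) * riemannZeta (2 * δ * s)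
            - deriv riemannZeta (2 * δ * s))) 0
      = ((Real.log 2 + Real.log a : ℝ) : ℂ) := by
  have hlin : ∀ s : ℂ, DifferentiableAt ℂ (fun s : ℂ => 2 * (δ : ℂ) * s) s := fun s => by fun_prop
  have hbase : ((4 * μ + 1 : ℝ) : ℂ) ≠ 0 := by
    exact_mod_cast (by positivity : (4 * μ + 1 : ℝ) ≠ 0)
  have hpi : (π : ℂ) ≠ 0 := by exact_mod_cast Real.pi_ne_zero
  have hpow : ∀ s : ℂ, DifferentiableAt ℂ (fun s : ℂ => ((4 * μ + 1 : ℝ) : ℂ) ^ (-s)) s :=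
    fun s => differentiableAt_id.neg.const_cpow (Or.inl hbase)
  have hzeta : ∀ s : ℂ, 2 * (δ : ℂ) * s ≠ 1 →
      DifferentiableAt ℂ (fun s : ℂ => ((Real.log (4 * π * a) : ℝ) : ℂ) * riemannZeta (2 * δ * s)
        - deriv riemannZeta (2 * δ * s)) s := fun s hs =>
    (((differentiableAt_riemannZeta hs).comp s (hlin s)).const_mul _).sub
      ((differentiableAt_deriv_riemannZeta hs).comp s (hlin s))
  have hsin : ∀ s : ℂ, HasDerivAt (fun s : ℂ => -2 * (Complex.sin (π * s) / π))
      (-2 * Complex.cos (π * s)) s := fun s => by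
    have h := ((((hasDerivAt_id s).const_mul (π : ℂ)).csin).div_const (π : ℂ)).const_mul (-2)
    refine h.congr_deriv ?_
    simp only [id]
    field_simp
  refine ⟨{s | 2 * (δ : ℂ) * s ≠ 1}, isOpen_ne_fun (by fun_prop) continuous_const, by simp,
    fun s hs => (((hsin s).differentiableAt.mul (hpow s)).mul
      (hzeta s hs)).differentiableWithinAt, by simp, ?_⟩
  have h := ((hsin 0).mul (hpow 0).hasDerivAt).mul (hzeta 0 (by simp)).hasDerivAt
  refine h.deriv.trans ?_
  have hlog : Real.log (4 * π * a) = Real.log (2 * π) + (Real.log 2 + Real.log a) := by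
    rw [← Real.log_mul (by norm_num) ha.ne', ← Real.log_mul (by positivity) (by positivity)]
    ring_nf
  have hlog_two_pi : Complex.log (2 * π) = ((Real.log (2 * π) : ℝ) : ℂ) := by
    rw [Complex.ofReal_log (by positivity)]
    push_cast
    rfl
  simp only [Pi.mul_apply, mul_zero, Complex.sin_zero, Complex.cos_zero, neg_zero,
    Complex.cpow_zero, zero_div, zero_mul, add_zero, riemannZeta_zero, deriv_riemannZeta_zero,
    hlog_two_pi, hlog]
  push_cast
  ring
end

section
/- Let a > 0 and α ∈ [0,1). For μ > 0 and nonzero integers k set A_k(μ) = 4π²(k+α)²a² + 1/4 + μ and B_k(μ) = 4π²(k−α)²a² + 1/4 + μ. Then the series S(μ) = ∑_{k ∈ ℤ, k ≠ 0} (√(A_k(μ)) + √(B_k(μ)))^{−1} · (A_k(μ)^{−1} + B_k(μ)^{−1}) converges for every μ > 0, and lim_{μ→+∞} ((4μ+1)/8) · S(μ) = 1/(2πa). -/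
open Real Filter

/-- The kernel `(c² x² + M)^(-3/2)`. -/
noncomputable def kernelThreeHalves (c M x : ℝ) : ℝ := (√(c ^ 2 * x ^ 2 + M))⁻¹ ^ 3

/-- The primitive of `kernelThreeHalves` that vanishes at `0`. -/
noncomputable def kernelPrimitive (c M x : ℝ) : ℝ := x / (M * √(c ^ 2 * x ^ 2 + M))

/-- The summand of the series, as a function of a real variable in place of the index. -/
noncomputable def shiftedTerm (c M α x : ℝ) : ℝ :=
  (√(c ^ 2 * (x + α) ^ 2 + M) + √(c ^ 2 * (x - α) ^ 2 + M))⁻¹ *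
    ((c ^ 2 * (x + α) ^ 2 + M)⁻¹ + (c ^ 2 * (x - α) ^ 2 + M)⁻¹)

lemma kernelThreeHalves_nonneg (c M x : ℝ) : 0 ≤ kernelThreeHalves c M x := by
  unfold kernelThreeHalves
  positivity

lemma shiftedTerm_neg (c M α x : ℝ) : shiftedTerm c M α (-x) = shiftedTerm c M α x := by
  have h₁ : (-x + α) ^ 2 = (x - α) ^ 2 := by ring
  have h₂ : (-x - α) ^ 2 = (x + α) ^ 2 := by ring
  simp only [shiftedTerm, h₁, h₂]
  ring

lemma kernelThreeHalves_anti {c M x y : ℝ} (hM : 0 < M) (hx : 0 ≤ x) (hxy : x ≤ y) :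
    kernelThreeHalves c M y ≤ kernelThreeHalves c M x := by
  unfold kernelThreeHalves
  have : 0 < √(c ^ 2 * x ^ 2 + M) := by positivity
  gcongr

lemma hasDerivAt_kernelPrimitive {c M : ℝ} (hM : 0 < M) (x : ℝ) :
    HasDerivAt (kernelPrimitive c M) (kernelThreeHalves c M x) x := by
  have hpos : 0 < c ^ 2 * x ^ 2 + M := by positivity
  have hr : 0 < √(c ^ 2 * x ^ 2 + M) := by positivity
  have hsq : √(c ^ 2 * x ^ 2 + M) ^ 2 = c ^ 2 * x ^ 2 + M := Real.sq_sqrt hpos.le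
  have hin : HasDerivAt (fun x : ℝ => c ^ 2 * x ^ 2 + M) (c ^ 2 * (2 * x)) x := by
    simpa using ((hasDerivAt_pow 2 x).const_mul (c ^ 2)).add_const M
  have hd := (hasDerivAt_id x).div ((hin.sqrt hpos.ne').const_mul M) (by positivity)
  refine hd.congr_deriv ?_
  simp only [kernelThreeHalves, id]
  field_simp
  rw [hsq]
  ring

lemma kernelPrimitive_sub_mem {c M x : ℝ} (hM : 0 < M) (hx : 0 ≤ x) :
    kernelThreeHalves c M (x + 1) ≤ kernelPrimitive c M (x + 1) - kernelPrimitive c M x ∧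
      kernelPrimitive c M (x + 1) - kernelPrimitive c M x ≤ kernelThreeHalves c M x := by
  obtain ⟨ξ, ⟨h₁, h₂⟩, h⟩ := exists_hasDerivAt_eq_slope (kernelPrimitive c M)
    (kernelThreeHalves c M) (lt_add_one x)
    (fun y _ => (hasDerivAt_kernelPrimitive hM y).continuousAt.continuousWithinAt)
    (fun y _ => hasDerivAt_kernelPrimitive hM y)
  rw [add_sub_cancel_left, div_one] at h
  rw [← h]
  exact ⟨kernelThreeHalves_anti hM (hx.trans h₁.le) h₂.le, kernelThreeHalves_anti hM hx h₁.le⟩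

lemma tendsto_kernelPrimitive {c M : ℝ} (hc : 0 < c) (hM : 0 < M) :
    Tendsto (kernelPrimitive c M) atTop (nhds (1 / (c * M))) := by
  have h₁ : Tendsto (fun x : ℝ => M * √(c ^ 2 + M * (x⁻¹) ^ 2)) atTop
      (nhds (M * √(c ^ 2 + M * 0 ^ 2))) :=
    ((((tendsto_inv_atTop_zero.pow 2).const_mul M).const_add (c ^ 2)).sqrt).const_mul M
  have hlim : M * √(c ^ 2 + M * 0 ^ 2) = c * M := by
    rw [zero_pow two_ne_zero, mul_zero, add_zero, Real.sqrt_sq hc.le, mul_comm]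
  rw [hlim] at h₁
  rw [one_div]
  refine (h₁.inv₀ (by positivity)).congr' ?_
  filter_upwards [eventually_gt_atTop 0] with x hx
  have : c ^ 2 * x ^ 2 + M = x ^ 2 * (c ^ 2 + M * (x⁻¹) ^ 2) := by
    field_simp
  rw [kernelPrimitive, this, Real.sqrt_mul (sq_nonneg x), Real.sqrt_sq hx.le]
  field_simp

lemma hasSum_kernelPrimitive_sub {c M : ℝ} (hc : 0 < c) (hM : 0 < M) :
    HasSum (fun n : ℕ => kernelPrimitive c M (n + 1) - kernelPrimitive c M n) (1 / (c * M)) := by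
  rw [hasSum_iff_tendsto_nat_of_nonneg fun n =>
    (kernelThreeHalves_nonneg c M _).trans (kernelPrimitive_sub_mem hM n.cast_nonneg).1]
  have h := (tendsto_kernelPrimitive hc hM).comp (tendsto_natCast_atTop_atTop (R := ℝ))
  refine h.congr fun n => ?_
  have := Finset.sum_range_sub (fun n : ℕ => kernelPrimitive c M n) n
  push_cast at this
  rw [this]
  simp [kernelPrimitive]

lemma summable_kernelThreeHalves {c M : ℝ} (hc : 0 < c) (hM : 0 < M) :
    Summable (fun n : ℕ => kernelThreeHalves c M n) := by
  rw [← summable_nat_add_iff 1]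
  refine .of_nonneg_of_le (fun n => kernelThreeHalves_nonneg c M _) (fun n => ?_)
    (hasSum_kernelPrimitive_sub hc hM).summable
  push_cast
  exact (kernelPrimitive_sub_mem hM n.cast_nonneg).1

lemma tsum_kernelThreeHalves_mem {c M : ℝ} (hc : 0 < c) (hM : 0 < M) :
    1 / (c * M) ≤ ∑' n : ℕ, kernelThreeHalves c M n ∧
      ∑' n : ℕ, kernelThreeHalves c M n ≤ kernelThreeHalves c M 0 + 1 / (c * M) := by
  have hs := summable_kernelThreeHalves hc hM
  have hG := hasSum_kernelPrimitive_sub hc hM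
  constructor
  · exact hasSum_le (fun n => (kernelPrimitive_sub_mem hM n.cast_nonneg).2) hG hs.hasSum
  · rw [hs.tsum_eq_zero_add, Nat.cast_zero]
    gcongr
    refine hasSum_le (fun n => ?_) ((summable_nat_add_iff 1).2 hs).hasSum hG
    push_cast
    exact (kernelPrimitive_sub_mem hM n.cast_nonneg).1

lemma shiftedTerm_mem {c M α x : ℝ} (hM : 0 < M) (hα0 : 0 ≤ α) (hα1 : α ≤ 1)
    (hx : 0 ≤ x) :
    kernelThreeHalves c M (x + 2) ≤ shiftedTerm c M α (x + 1) ∧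
      shiftedTerm c M α (x + 1) ≤ kernelThreeHalves c M x := by
  have hrpos : ∀ y : ℝ, 0 < √(c ^ 2 * y ^ 2 + M) := fun y => by positivity
  have hsq : ∀ y : ℝ, c ^ 2 * y ^ 2 + M = √(c ^ 2 * y ^ 2 + M) ^ 2 :=
    fun y => (Real.sq_sqrt (by positivity)).symm
  have hmono : ∀ y z : ℝ, 0 ≤ y → y ≤ z → √(c ^ 2 * y ^ 2 + M) ≤ √(c ^ 2 * z ^ 2 + M) :=
    fun y z hy hyz => by gcongr
  have key : ∀ r : ℝ, 0 < r → r⁻¹ ^ 3 = (r + r)⁻¹ * ((r ^ 2)⁻¹ + (r ^ 2)⁻¹) := by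
    intro r hr
    field_simp
  have h₁ := hmono x (x + 1 + α) hx (by linarith)
  have h₂ := hmono x (x + 1 - α) hx (by linarith)
  have h₃ := hmono (x + 1 + α) (x + 2) (by linarith) (by linarith)
  have h₄ := hmono (x + 1 - α) (x + 2) (by linarith) (by linarith)
  have p₀ := hrpos x
  have p₁ := hrpos (x + 1 + α)
  have p₂ := hrpos (x + 1 - α)
  have e : shiftedTerm c M α (x + 1) =
      (√(c ^ 2 * (x + 1 + α) ^ 2 + M) + √(c ^ 2 * (x + 1 - α) ^ 2 + M))⁻¹ *
        ((√(c ^ 2 * (x + 1 + α) ^ 2 + M) ^ 2)⁻¹ + (√(c ^ 2 * (x + 1 - α) ^ 2 + M) ^ 2)⁻¹) := by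
    rw [← hsq, ← hsq, shiftedTerm]
  rw [e, kernelThreeHalves, kernelThreeHalves, key _ (hrpos _), key _ (hrpos _)]
  constructor <;> gcongr

lemma shiftedTerm_nonneg {c M : ℝ} (hM : 0 ≤ M) (α x : ℝ) : 0 ≤ shiftedTerm c M α x := by
  unfold shiftedTerm
  positivity

lemma summable_shiftedTerm {c M α : ℝ} (hc : 0 < c) (hM : 0 < M) (hα0 : 0 ≤ α) (hα1 : α ≤ 1) :
    Summable (fun n : ℕ => shiftedTerm c M α (n + 1)) :=
  .of_nonneg_of_le (fun _ => shiftedTerm_nonneg hM.le α _)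
    (fun n => (shiftedTerm_mem hM hα0 hα1 n.cast_nonneg).2) (summable_kernelThreeHalves hc hM)

lemma tsum_shiftedTerm_mem {c M α : ℝ} (hc : 0 < c) (hM : 0 < M) (hα0 : 0 ≤ α) (hα1 : α ≤ 1) :
    1 / (c * M) - 2 * kernelThreeHalves c M 0 ≤ ∑' n : ℕ, shiftedTerm c M α (n + 1) ∧
      ∑' n : ℕ, shiftedTerm c M α (n + 1) ≤ kernelThreeHalves c M 0 + 1 / (c * M) := by
  have hs := summable_kernelThreeHalves hc hM
  have ht := summable_shiftedTerm hc hM hα0 hα1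
  obtain ⟨hl, hu⟩ := tsum_kernelThreeHalves_mem hc hM
  constructor
  · have h := ((summable_nat_add_iff 2).2 hs).tsum_le_tsum (fun n => ?_) ht
    · have hsplit := hs.sum_add_tsum_nat_add 2
      have hanti : kernelThreeHalves c M 1 ≤ kernelThreeHalves c M 0 :=
        kernelThreeHalves_anti hM le_rfl zero_le_one
      simp only [Finset.sum_range_succ, Finset.sum_range_zero, Nat.cast_zero, Nat.cast_one,
        zero_add] at hsplit
      linarith
    · push_cast
      exact (shiftedTerm_mem hM hα0 hα1 n.cast_nonneg).1
  · exact (ht.tsum_le_tsum (fun n => (shiftedTerm_mem hM hα0 hα1 n.cast_nonneg).2) hs).trans hu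

lemma hasSum_ne_zero_of_even {f : ℤ → ℝ} (hf : ∀ k, f (-k) = f k)
    (hs : Summable (fun n : ℕ => f (n + 1))) :
    HasSum (fun k : {k : ℤ // k ≠ 0} => f k) (2 * ∑' n : ℕ, f (n + 1)) := by
  have hg₁ : HasSum (fun n : ℕ => Set.indicator {k : ℤ | k ≠ 0} f (n + 1))
      (∑' n : ℕ, f (n + 1)) := by
    refine hs.hasSum.congr_fun fun n => ?_
    exact Set.indicator_of_mem (s := {k : ℤ | k ≠ 0}) (show (n : ℤ) + 1 ≠ 0 by lia) f
  have hg₂ : HasSum (fun n : ℕ => Set.indicator {k : ℤ | k ≠ 0} f (-(n + 1)))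
      (∑' n : ℕ, f (n + 1)) := by
    refine hs.hasSum.congr_fun fun n => ?_
    rw [← hf]
    exact Set.indicator_of_mem (s := {k : ℤ | k ≠ 0}) (show -((n : ℤ) + 1) ≠ 0 by lia) f
  have h := hg₁.of_add_one_of_neg_add_one hg₂
  rw [Set.indicator_of_notMem (by simp), add_zero, ← two_mul] at h
  exact hasSum_subtype_iff_indicator.2 h

lemma hasSum_shiftedTerm {c M α : ℝ} (hc : 0 < c) (hM : 0 < M) (hα0 : 0 ≤ α) (hα1 : α ≤ 1) :
    HasSum (fun k : {k : ℤ // k ≠ 0} => shiftedTerm c M α ((k : ℤ) : ℝ))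
      (2 * ∑' n : ℕ, shiftedTerm c M α (n + 1)) := by
  have h := hasSum_ne_zero_of_even (f := fun k : ℤ => shiftedTerm c M α k)
    (fun k => by simp [shiftedTerm_neg])
    (by simpa using summable_shiftedTerm hc hM hα0 hα1)
  simpa using h

lemma tendsto_mul_tsum_shiftedTerm {c α : ℝ} (hc : 0 < c) (hα0 : 0 ≤ α) (hα1 : α ≤ 1) :
    Tendsto (fun M : ℝ => M / 2 * ∑' k : {k : ℤ // k ≠ 0}, shiftedTerm c M α ((k : ℤ) : ℝ))
      atTop (nhds (1 / c)) := by
  have hinv : Tendsto (fun M : ℝ => (√M)⁻¹) atTop (nhds 0) :=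
    tendsto_inv_atTop_zero.comp Real.tendsto_sqrt_atTop
  have hl : Tendsto (fun M : ℝ => 1 / c - 2 * (√M)⁻¹) atTop (nhds (1 / c)) := by
    simpa using (hinv.const_mul 2).const_sub (1 / c)
  have hu : Tendsto (fun M : ℝ => (√M)⁻¹ + 1 / c) atTop (nhds (1 / c)) := by
    simpa using hinv.add_const (1 / c)
  have hzero : ∀ M : ℝ, 0 < M → M * kernelThreeHalves c M 0 = (√M)⁻¹ := by
    intro M hM
    have hr : 0 < √M := Real.sqrt_pos.2 hM
    have hsq : √M ^ 2 = M := Real.sq_sqrt hM.le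
    simp only [kernelThreeHalves, zero_pow two_ne_zero, mul_zero, zero_add]
    nth_rewrite 1 [← hsq]
    field_simp
  have hone : ∀ M : ℝ, 0 < M → M * (1 / (c * M)) = 1 / c := by
    intro M hM
    field_simp
  refine tendsto_of_tendsto_of_tendsto_of_le_of_le' hl hu ?_ ?_ <;>
    filter_upwards [eventually_gt_atTop 0] with M hM
  all_goals
    rw [(hasSum_shiftedTerm hc hM hα0 hα1).tsum_eq, ← mul_assoc, div_mul_cancel₀ _ two_ne_zero]
    obtain ⟨h₁, h₂⟩ := tsum_shiftedTerm_mem hc hM hα0 hα1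
    have h₃ := mul_le_mul_of_nonneg_left h₁ hM.le
    have h₄ := mul_le_mul_of_nonneg_left h₂ hM.le
    rw [mul_sub, hone M hM, mul_left_comm, hzero M hM] at h₃
    rw [mul_add, hone M hM, hzero M hM] at h₄
    assumption

/-- The quantities `A_k(μ)` and `B_k(μ)` and the series `S(μ)` from the eighth
part of the study of the terms `A_{μ,k}`: the series converges for every `μ > 0`
and `((4μ+1)/8) S(μ) → 1/(2πa)` as `μ → +∞`. -/
theorem stmt17 (a α : ℝ) (ha : 0 < a) (hα0 : 0 ≤ α) (hα1 : α < 1) :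
    (∀ μ : ℝ, 0 < μ → Summable (fun k : {k : ℤ // k ≠ 0} =>
      (Real.sqrt (4 * π ^ 2 * (((k : ℤ) : ℝ) + α) ^ 2 * a ^ 2 + 1 / 4 + μ) +
          Real.sqrt (4 * π ^ 2 * (((k : ℤ) : ℝ) - α) ^ 2 * a ^ 2 + 1 / 4 + μ))⁻¹ *
        ((4 * π ^ 2 * (((k : ℤ) : ℝ) + α) ^ 2 * a ^ 2 + 1 / 4 + μ)⁻¹ +
          (4 * π ^ 2 * (((k : ℤ) : ℝ) - α) ^ 2 * a ^ 2 + 1 / 4 + μ)⁻¹))) ∧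
    Tendsto (fun μ : ℝ => ((4 * μ + 1) / 8) *
        ∑' k : {k : ℤ // k ≠ 0},
          (Real.sqrt (4 * π ^ 2 * (((k : ℤ) : ℝ) + α) ^ 2 * a ^ 2 + 1 / 4 + μ) +
              Real.sqrt (4 * π ^ 2 * (((k : ℤ) : ℝ) - α) ^ 2 * a ^ 2 + 1 / 4 + μ))⁻¹ *
            ((4 * π ^ 2 * (((k : ℤ) : ℝ) + α) ^ 2 * a ^ 2 + 1 / 4 + μ)⁻¹ +
              (4 * π ^ 2 * (((k : ℤ) : ℝ) - α) ^ 2 * a ^ 2 + 1 / 4 + μ)⁻¹))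
      atTop (nhds (1 / (2 * π * a))) := by
  have hc : 0 < 2 * π * a := by positivity
  have hterm : ∀ μ x : ℝ,
      (√(4 * π ^ 2 * (x + α) ^ 2 * a ^ 2 + 1 / 4 + μ) +
          √(4 * π ^ 2 * (x - α) ^ 2 * a ^ 2 + 1 / 4 + μ))⁻¹ *
        ((4 * π ^ 2 * (x + α) ^ 2 * a ^ 2 + 1 / 4 + μ)⁻¹ +
          (4 * π ^ 2 * (x - α) ^ 2 * a ^ 2 + 1 / 4 + μ)⁻¹) =
      shiftedTerm (2 * π * a) (1 / 4 + μ) α x := by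
    intro μ x
    have h : ∀ y : ℝ, 4 * π ^ 2 * y ^ 2 * a ^ 2 + 1 / 4 + μ =
        (2 * π * a) ^ 2 * y ^ 2 + (1 / 4 + μ) := fun y => by ring
    simp only [shiftedTerm, h]
  simp only [hterm]
  refine ⟨fun μ hμ => (hasSum_shiftedTerm hc (by positivity) hα0 hα1.le).summable, ?_⟩
  have h := (tendsto_mul_tsum_shiftedTerm hc hα0 hα1.le).comp
    (tendsto_atTop_add_const_left atTop (1 / 4 : ℝ) tendsto_id)
  refine h.congr fun μ => ?_
  simp only [Function.comp_apply, id]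
  congr 1
  ring
end

section
/- Let a > 0, μ ≥ 0, α ∈ [0,1) and δ ∈ (0,1). For nonzero integers k set A_k = 4π²(k+α)²a² + (4μ+1)|k|^{2δ} and B_k = 4π²(k−α)²a² + (4μ+1)|k|^{2δ}. Then the series Φ(s) = (1/2) · (sin(πs)/π) · (4μ+1)^{1−s} · ∑_{k ∈ ℤ, k ≠ 0} (|k|^{2δ} − 1/4)^{−s} · |k|^{2δ} · (√(A_k) + √(B_k))^{−1} · (A_k^{−1} + B_k^{−1}) converges locally uniformly on a neighborhood of s = 0 in ℂ, the function Φ is holomorphic there, and Φ(0) = 0. -/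
open Real Complex Filter

/-- The `k`-th term of the series `Φ(s)` from the fifth part of the study of the
terms `A_{μ,k}`: with `A_k = 4π²(k+α)²a² + (4μ+1)|k|^{2δ}` and
`B_k = 4π²(k-α)²a² + (4μ+1)|k|^{2δ}`, it is
`(1/2)(sin(πs)/π)(4μ+1)^{1-s} (|k|^{2δ}-1/4)^{-s} |k|^{2δ} (√A_k+√B_k)⁻¹ (A_k⁻¹+B_k⁻¹)`. -/
noncomputable def phiTerm (a μ α δ : ℝ) (k : {k : ℤ // k ≠ 0}) (s : ℂ) : ℂ :=
  (1 / 2) * (Complex.sin (π * s) / π) * ((4 * μ + 1 : ℝ) : ℂ) ^ (1 - s) *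
    ((|((k : ℤ) : ℝ)| ^ (2 * δ) - 1 / 4 : ℝ) : ℂ) ^ (-s) *
    ((|((k : ℤ) : ℝ)| ^ (2 * δ) : ℝ) : ℂ) *
    (((Real.sqrt (4 * π ^ 2 * (((k : ℤ) : ℝ) + α) ^ 2 * a ^ 2
          + (4 * μ + 1) * |((k : ℤ) : ℝ)| ^ (2 * δ)) +
        Real.sqrt (4 * π ^ 2 * (((k : ℤ) : ℝ) - α) ^ 2 * a ^ 2
          + (4 * μ + 1) * |((k : ℤ) : ℝ)| ^ (2 * δ)))⁻¹ : ℝ) : ℂ) *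
    ((((4 * π ^ 2 * (((k : ℤ) : ℝ) + α) ^ 2 * a ^ 2
          + (4 * μ + 1) * |((k : ℤ) : ℝ)| ^ (2 * δ))⁻¹ +
        (4 * π ^ 2 * (((k : ℤ) : ℝ) - α) ^ 2 * a ^ 2
          + (4 * μ + 1) * |((k : ℤ) : ℝ)| ^ (2 * δ))⁻¹ : ℝ)) : ℂ)

/-- A shifted square `(m + β)²` with `|β| ≤ α < 1 ≤ |m|` dominates `((1 - α) m)²`. -/
lemma sq_one_sub_mul_abs_le {m α β : ℝ} (hm : 1 ≤ |m|) (hα : α < 1) (hβ : |β| ≤ α) :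
    ((1 - α) * |m|) ^ 2 ≤ (m + β) ^ 2 := by
  rw [← sq_abs (m + β)]
  have h : |m| - |β| ≤ |m + β| := by simpa using abs_sub_abs_le_abs_sub m (-β)
  have h₀ : 0 ≤ (1 - α) * |m| := mul_nonneg (by linarith) (abs_nonneg m)
  have h₁ : α ≤ α * |m| := le_mul_of_one_le_right ((abs_nonneg β).trans hβ) hm
  exact pow_le_pow_left₀ h₀ (by linarith) 2

lemma inv_sqrt_add_sqrt_mul_inv_add_inv_le {t A B : ℝ} (ht : 0 < t) (hA : t ^ 2 ≤ A)
    (hB : t ^ 2 ≤ B) : (√A + √B)⁻¹ * (A⁻¹ + B⁻¹) ≤ (t ^ 3)⁻¹ := by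
  have hA' : t ≤ √A := Real.le_sqrt_of_sq_le hA
  have hB' : t ≤ √B := Real.le_sqrt_of_sq_le hB
  have ht2 : 0 < t ^ 2 := by positivity
  have h₁ : (√A + √B)⁻¹ ≤ (t + t)⁻¹ := by gcongr
  have h₂ : A⁻¹ + B⁻¹ ≤ (t ^ 2)⁻¹ + (t ^ 2)⁻¹ := by gcongr
  have hA0 : 0 < A := ht2.trans_le hA
  have hB0 : 0 < B := ht2.trans_le hB
  calc (√A + √B)⁻¹ * (A⁻¹ + B⁻¹) ≤ (t + t)⁻¹ * ((t ^ 2)⁻¹ + (t ^ 2)⁻¹) := by gcongr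
    _ = (t ^ 3)⁻¹ := by field_simp

lemma sub_quarter_rpow_neg_le {y σ r : ℝ} (hy : 1 ≤ y) (hσ : |σ| ≤ r) (hr : r ≤ 1) :
    (y - 1 / 4) ^ (-σ) ≤ 2 * y ^ r := by
  obtain ⟨hσ₁, hσ₂⟩ := abs_le.1 hσ
  have hyr : 1 ≤ y ^ r := Real.one_le_rpow hy ((abs_nonneg σ).trans hσ)
  rcases le_total σ 0 with h | h
  · calc (y - 1 / 4) ^ (-σ) ≤ y ^ (-σ) :=
          Real.rpow_le_rpow (by linarith) (by linarith) (by linarith)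
      _ ≤ y ^ r := Real.rpow_le_rpow_of_exponent_le hy (by linarith)
      _ ≤ 2 * y ^ r := by linarith
  · calc (y - 1 / 4) ^ (-σ) ≤ (3 / 4 : ℝ) ^ (-σ) :=
          Real.rpow_le_rpow_of_nonpos (by norm_num) (by linarith) (by linarith)
      _ ≤ (3 / 4 : ℝ) ^ (-1 : ℝ) :=
          Real.rpow_le_rpow_of_exponent_ge (by norm_num) (by norm_num) (by linarith)
      _ ≤ 2 * y ^ r := by rw [Real.rpow_neg_one]; linarith

lemma one_le_abs_intCast_of_ne_zero {k : ℤ} (hk : k ≠ 0) : (1 : ℝ) ≤ |(k : ℝ)| := by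
  exact_mod_cast Int.one_le_abs hk

/-- The factor of `phiTerm` that does not depend on the summation index. -/
noncomputable def phiPrefactor (μ : ℝ) (s : ℂ) : ℂ :=
  (1 / 2) * (Complex.sin (π * s) / π) * ((4 * μ + 1 : ℝ) : ℂ) ^ (1 - s)

lemma differentiable_phiPrefactor {μ : ℝ} (hμ : 0 ≤ μ) : Differentiable ℂ (phiPrefactor μ) := by
  have h : ((4 * μ + 1 : ℝ) : ℂ) ≠ 0 := by
    rw [Complex.ofReal_ne_zero]; positivity
  unfold phiPrefactor
  refine Differentiable.mul (by fun_prop) ?_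
  exact Differentiable.const_cpow (by fun_prop) (Or.inl h)

lemma differentiable_phiTerm {a μ α δ : ℝ} (hμ : 0 ≤ μ) (hδ : 0 < δ) (k : {k : ℤ // k ≠ 0}) :
    Differentiable ℂ (phiTerm a μ α δ k) := by
  have hy : 1 ≤ |((k : ℤ) : ℝ)| ^ (2 * δ) :=
    Real.one_le_rpow (one_le_abs_intCast_of_ne_zero k.2) (by linarith)
  have hx : ((|((k : ℤ) : ℝ)| ^ (2 * δ) - 1 / 4 : ℝ) : ℂ) ≠ 0 := by
    rw [Complex.ofReal_ne_zero]; linarith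
  have hpow : Differentiable ℂ
      fun s : ℂ => ((|((k : ℤ) : ℝ)| ^ (2 * δ) - 1 / 4 : ℝ) : ℂ) ^ (-s) :=
    Differentiable.const_cpow (by fun_prop) (Or.inl hx)
  exact ((((differentiable_phiPrefactor hμ).mul hpow).mul_const _).mul_const _).mul_const _

lemma norm_phiTerm_le {a μ α δ r : ℝ} (ha : 0 < a) (hμ : 0 ≤ μ) (hα0 : 0 ≤ α) (hα1 : α < 1)
    (hδ : 0 < δ) (hr : r ≤ 1) (k : {k : ℤ // k ≠ 0}) {s : ℂ} (hs : ‖s‖ ≤ r) :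
    ‖phiTerm a μ α δ k s‖ ≤ ‖phiPrefactor μ s‖ *
      (2 * ((2 * π * a * (1 - α)) ^ 3)⁻¹ * |((k : ℤ) : ℝ)| ^ (-(3 - 2 * δ - 2 * δ * r))) := by
  have hn := one_le_abs_intCast_of_ne_zero k.2
  unfold phiTerm
  rw [← phiPrefactor]
  generalize ((k : ℤ) : ℝ) = m at hn ⊢
  have hm : 0 < |m| := by linarith
  have hy : 1 ≤ |m| ^ (2 * δ) := Real.one_le_rpow hn (by linarith)
  have h1α : 0 < 1 - α := by linarith
  have hshift {β : ℝ} (hβ : |β| ≤ α) : (2 * π * a * (1 - α) * |m|) ^ 2 ≤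
      4 * π ^ 2 * (m + β) ^ 2 * a ^ 2 + (4 * μ + 1) * |m| ^ (2 * δ) := by
    have h := mul_le_mul_of_nonneg_left (sq_one_sub_mul_abs_le hn hα1 hβ)
      (show 0 ≤ 4 * π ^ 2 * a ^ 2 by positivity)
    have : 0 ≤ (4 * μ + 1) * |m| ^ (2 * δ) := by positivity
    linarith
  have hA := hshift (β := α) (abs_of_nonneg hα0).le
  have hB := hshift (β := -α) (by rw [abs_neg, abs_of_nonneg hα0])
  rw [← sub_eq_add_neg] at hB
  generalize 4 * π ^ 2 * (m + α) ^ 2 * a ^ 2 + (4 * μ + 1) * |m| ^ (2 * δ) = A at hA ⊢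
  generalize 4 * π ^ 2 * (m - α) ^ 2 * a ^ 2 + (4 * μ + 1) * |m| ^ (2 * δ) = B at hB ⊢
  have ht : 0 < 2 * π * a * (1 - α) * |m| := by positivity
  have hA0 : 0 ≤ A := (sq_nonneg _).trans hA
  have hB0 : 0 ≤ B := (sq_nonneg _).trans hB
  have hAB := inv_sqrt_add_sqrt_mul_inv_add_inv_le ht hA hB
  have hpow := sub_quarter_rpow_neg_le hy ((Complex.abs_re_le_norm s).trans hs) hr
  simp only [norm_mul, Complex.norm_real, Real.norm_eq_abs]
  rw [Complex.norm_cpow_eq_rpow_re_of_pos (by linarith), Complex.neg_re,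
    abs_of_nonneg (by positivity : 0 ≤ |m| ^ (2 * δ)),
    abs_of_nonneg (by positivity : 0 ≤ (√A + √B)⁻¹),
    abs_of_nonneg (by positivity : 0 ≤ A⁻¹ + B⁻¹)]
  have hexp : |m| ^ (-(3 - 2 * δ - 2 * δ * r)) =
      (|m| ^ (2 * δ)) ^ r * |m| ^ (2 * δ) * (|m| ^ 3)⁻¹ := by
    rw [← Real.rpow_mul hm.le, ← Real.rpow_add hm, ← Real.rpow_natCast,
      ← Real.rpow_neg hm.le, ← Real.rpow_add hm]
    congr 1
    push_cast
    ring
  calc _ = ‖phiPrefactor μ s‖ * ((|m| ^ (2 * δ) - 1 / 4) ^ (-s.re) * |m| ^ (2 * δ) *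
        ((√A + √B)⁻¹ * (A⁻¹ + B⁻¹))) := by ring
    _ ≤ ‖phiPrefactor μ s‖ * (2 * (|m| ^ (2 * δ)) ^ r * |m| ^ (2 * δ) *
        ((2 * π * a * (1 - α) * |m|) ^ 3)⁻¹) := by gcongr
    _ = _ := by rw [hexp, mul_pow _ |m|, mul_inv]; ring

/-- The series `Φ(s)` converges locally uniformly on a neighborhood of `0`, its
sum is holomorphic there, and `Φ(0) = 0`. -/
theorem stmt18 (a μ α δ : ℝ) (ha : 0 < a) (hμ : 0 ≤ μ)
    (hα0 : 0 ≤ α) (hα1 : α < 1) (hδ0 : 0 < δ) (hδ1 : δ < 1) :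
    ∃ U : Set ℂ, IsOpen U ∧ (0 : ℂ) ∈ U ∧
      (∀ s ∈ U, Summable (fun k : {k : ℤ // k ≠ 0} => phiTerm a μ α δ k s)) ∧
      TendstoLocallyUniformlyOn
        (fun (N : Finset {k : ℤ // k ≠ 0}) (s : ℂ) => ∑ k ∈ N, phiTerm a μ α δ k s)
        (fun s : ℂ => ∑' k : {k : ℤ // k ≠ 0}, phiTerm a μ α δ k s) atTop U ∧
      DifferentiableOn ℂ
        (fun s : ℂ => ∑' k : {k : ℤ // k ≠ 0}, phiTerm a μ α δ k s) U ∧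
      (∑' k : {k : ℤ // k ≠ 0}, phiTerm a μ α δ k 0) = 0 := by
  obtain ⟨r, hr0, hr1, hr⟩ : ∃ r : ℝ, 0 < r ∧ r ≤ 1 ∧ 1 < 3 - 2 * δ - 2 * δ * r :=
    ⟨(1 - δ) / 2, by linarith, by linarith, by nlinarith⟩
  obtain ⟨M, hM⟩ := (isCompact_closedBall (0 : ℂ) r).exists_bound_of_continuousOn
    (differentiable_phiPrefactor hμ).continuous.continuousOn
  have hc : 0 < 1 - α := by linarith
  have hbound (k : {k : ℤ // k ≠ 0}) (s : ℂ) (hs : s ∈ Metric.ball (0 : ℂ) r) :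
      ‖phiTerm a μ α δ k s‖ ≤ M * (2 * ((2 * π * a * (1 - α)) ^ 3)⁻¹ *
        |((k : ℤ) : ℝ)| ^ (-(3 - 2 * δ - 2 * δ * r))) := by
    have hs' := Metric.ball_subset_closedBall hs
    refine (norm_phiTerm_le ha hμ hα0 hα1 hδ0 hr1 k (mem_closedBall_zero_iff.1 hs')).trans ?_
    gcongr
    exact hM s hs'
  have hsum : Summable fun k : {k : ℤ // k ≠ 0} => M * (2 * ((2 * π * a * (1 - α)) ^ 3)⁻¹ *
      |((k : ℤ) : ℝ)| ^ (-(3 - 2 * δ - 2 * δ * r))) :=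
    (((Real.summable_abs_int_rpow hr).comp_injective Subtype.val_injective).mul_left _).mul_left _
  refine ⟨Metric.ball 0 r, Metric.isOpen_ball, Metric.mem_ball_self hr0,
    fun s hs => hsum.of_norm_bounded fun k => hbound k s hs,
    (tendstoUniformlyOn_tsum hsum hbound).tendstoLocallyUniformlyOn,
    Complex.differentiableOn_tsum_of_summable_norm hsum
      (fun k => (differentiable_phiTerm hμ hδ0 k).differentiableOn) Metric.isOpen_ball hbound, ?_⟩
  simp [phiTerm]
end
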